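/- arXiv:1205.1735 — 3 statements merged into one kernel-verified Lean document; each statement's English description precedes it below -/
import Mathlib

section
/- Let ν, ρ, ϑ > 0 with ν + ϑρ > 1, let V and W be Banach spaces, I ⊆ ℝ an interval, G ∈ C^{0,ν}(I, C^{0,ϑ}(V,W)) and f ∈ C^{0,ρ}(I,V). Then for all s ≤ t in I the Riemann sums Σ_{i=0}^{n−1} (G_{t_{i+1}} − G_{t_i})(f_{t_i}) over partitions s = t₀ < t₁ < … < t_n = t converge in W as the mesh of the partition tends to 0, and the limit ∫_s^t G_{du}(f_u) is independent of the choice of partitions; moreover for s ≤ u ≤ t in I one has the additivity (Chasles) relation ∫_s^t G_{dr}(f_r) = ∫_s^u G_{dr}(f_r) + ∫_u^t G_{dr}(f_r). -/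
open MeasureTheory Filter Topology
open scoped ENNReal NNReal

noncomputable section

abbrev Euc (d : ℕ) : Type := EuclideanSpace ℝ (Fin d)

/-- `Y^w_{s,t}(ω,ξ) = ∫_s^t exp(i ξ·w_u + i ω u) du`. -/
def Yint {d : ℕ} (w : ℝ → Euc d) (s t ω : ℝ) (ξ : Euc d) : ℂ :=
  ∫ u in s..t, Complex.exp (Complex.I * Complex.ofReal (inner ℝ ξ (w u) + ω * u))

/-- The averaging constant `K^w_{α,γ}`. -/
def avgK {d : ℕ} (w : ℝ → Euc d) (α γ : ℝ) : ℝ≥0∞ :=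
  ⨆ (s : ℝ) (t : ℝ) (_ : 0 ≤ s) (_ : s < t) (_ : t ≤ 1) (ω : ℝ) (ξ : Euc d),
    ENNReal.ofReal (‖Yint w s t ω ξ‖ /
      ((1 + ‖ξ‖) ^ α * (1 + Real.sqrt (Real.log (1 + |ω|))) * (t - s) ^ γ))

/-- The norm `N_α` of a space-time vector field given through its Fourier transform `bhat`. -/
def FLnorm (d : ℕ) (α : ℝ) (bhat : ℝ × Euc d → Fin d → ℂ) : ℝ≥0∞ :=
  ∫⁻ p : ℝ × Euc d, ENNReal.ofReal (‖bhat p‖ * (1 + ‖p.2‖) ^ α *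
    (1 + Real.sqrt (Real.log (1 + |p.1|))))

/-- The vector field `b(t,x)` recovered from its space-time Fourier transform. -/
def fieldOf {d : ℕ} (bhat : ℝ × Euc d → Fin d → ℂ) (t : ℝ) (x : Euc d) : Euc d :=
  (EuclideanSpace.equiv (Fin d) ℝ).symm fun i =>
    ∫ p : ℝ × Euc d, (bhat p i * Complex.exp (Complex.I * Complex.ofReal (p.1 * t + inner ℝ p.2 x))).re

/-- The averaged vector field `σ^w_{[s,t]} b`, defined through the Fourier representation. -/
def sigmaAvg {d : ℕ} (w : ℝ → Euc d) (bhat : ℝ × Euc d → Fin d → ℂ) (s t : ℝ) (x : Euc d) :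
    Euc d :=
  (EuclideanSpace.equiv (Fin d) ℝ).symm fun i =>
    ∫ p : ℝ × Euc d, (bhat p i * Yint w s t p.1 p.2 *
      Complex.exp (Complex.I * Complex.ofReal (inner ℝ p.2 x))).re

/-- Partitions of the interval `[s,t]`. -/
structure IntervalPartition (s t : ℝ) where
  n : ℕ
  pts : ℕ → ℝ
  first : pts 0 = s
  last : pts n = t
  mono : ∀ i, i < n → pts i ≤ pts (i + 1)

/-- The mesh of the partition is smaller than `δ`. -/
def IntervalPartition.MeshLt {s t : ℝ} (P : IntervalPartition s t) (δ : ℝ) : Prop :=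
  ∀ i, i < P.n → P.pts (i + 1) - P.pts i < δ

/-- Riemann sums `Σ_i (G_{t_{i+1}} - G_{t_i})(f_{t_i})` of the nonlinear Young integral. -/
def RiemannSum {V W : Type*} [AddCommGroup W] (G : ℝ → V → W) (f : ℝ → V)
    {s t : ℝ} (P : IntervalPartition s t) : W :=
  ∑ i ∈ Finset.range P.n, (G (P.pts (i + 1)) (f (P.pts i)) - G (P.pts i) (f (P.pts i)))

/-- `L` is the nonlinear Young integral `∫_s^t G_{du}(f_u)`: the Riemann sums converge to `L`
as the mesh of the partition tends to `0`. -/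
def HasYoungIntegral {V W : Type*} [NormedAddCommGroup W] (G : ℝ → V → W) (f : ℝ → V)
    (s t : ℝ) (L : W) : Prop :=
  ∀ ε > 0, ∃ δ > 0, ∀ P : IntervalPartition s t, P.MeshLt δ → ‖RiemannSum G f P - L‖ < ε

/-- Riemann sums `Σ_i (σ^w_{[t_i,t_{i+1}]} b)(θ_{t_i})`. -/
def sigmaRiemannSum {d : ℕ} (w : ℝ → Euc d) (bhat : ℝ × Euc d → Fin d → ℂ)
    (θ : ℝ → Euc d) {s t : ℝ} (P : IntervalPartition s t) : Euc d :=
  ∑ i ∈ Finset.range P.n, sigmaAvg w bhat (P.pts i) (P.pts (i + 1)) (θ (P.pts i))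

/-- `L = ∫_s^t (σ^w_{du} b)(θ_u)` as a limit of Riemann sums. -/
def HasSigmaIntegral {d : ℕ} (w : ℝ → Euc d) (bhat : ℝ × Euc d → Fin d → ℂ)
    (θ : ℝ → Euc d) (s t : ℝ) (L : Euc d) : Prop :=
  ∀ ε > 0, ∃ δ > 0, ∀ P : IntervalPartition s t, P.MeshLt δ → ‖sigmaRiemannSum w bhat θ P - L‖ < ε

/-- `θ` solves the Young equation `θ_t = x₀ + ∫_0^t (σ^w_{du} b)(θ_u)` on `[0,1]`. -/
def SolvesSigmaYoung {d : ℕ} (w : ℝ → Euc d) (bhat : ℝ × Euc d → Fin d → ℂ)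
    (x₀ : Euc d) (θ : ℝ → Euc d) : Prop :=
  θ 0 = x₀ ∧ ∀ t ∈ Set.Icc (0 : ℝ) 1, HasSigmaIntegral w bhat θ 0 t (θ t - x₀)

/-- `γ`-Hölder continuity on `[0,1]`. -/
def HolderOnIcc {E : Type*} [NormedAddCommGroup E] (γ : ℝ) (f : ℝ → E) : Prop :=
  ∃ C : ℝ, ∀ s ∈ Set.Icc (0 : ℝ) 1, ∀ t ∈ Set.Icc (0 : ℝ) 1, ‖f t - f s‖ ≤ C * |t - s| ^ γ

/-- Covariance of the fractional Brownian motion of Hurst index `H`. -/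
def fbmCov (H : ℝ) (s t : ℝ) : ℝ := (s ^ (2 * H) + t ^ (2 * H) - |t - s| ^ (2 * H)) / 2

/-- `W` is a `d`-dimensional fractional Brownian motion of Hurst parameter `H` with continuous
sample paths: the coordinates are independent centered Gaussian processes with the fBm
covariance, expressed by asking every finite linear combination to be Gaussian. -/
def IsFBM {Ω : Type*} [MeasureSpace Ω] (d : ℕ) (H : ℝ) (W : Ω → ℝ → Euc d) : Prop :=
  (∀ ω, ContinuousOn (W ω) (Set.Icc 0 1)) ∧
  (∀ t, Measurable fun ω => W ω t) ∧
  (∀ ω, W ω 0 = 0) ∧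
  ∀ (n : ℕ) (c : Fin n → ℝ) (t : Fin n → ℝ) (j : Fin n → Fin d),
    (∀ k, t k ∈ Set.Icc (0 : ℝ) 1) →
    Measure.map (fun ω => ∑ k, c k * W ω (t k) (j k)) (volume : Measure Ω) =
      ProbabilityTheory.gaussianReal 0
        (Real.toNNReal (∑ k, ∑ l, c k * c l *
          (if j k = j l then fbmCov H (t k) (t l) else 0)))

/-- `R^w_λ = (∫_0^1 exp(λ |w_u|²) du)^{1/λ}`. -/
def Rconst {d : ℕ} (lam : ℝ) (w : ℝ → Euc d) : ℝ≥0∞ :=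
  (∫⁻ u in Set.Icc (0 : ℝ) 1, ENNReal.ofReal (Real.exp (lam * ‖w u‖ ^ 2))) ^ (1 / lam)

/-- `S^w_λ`. -/
def Sconst {d : ℕ} (H lam : ℝ) (w : ℝ → Euc d) : ℝ≥0∞ :=
  (∑' n : ℕ, ∑' m : ℕ, ∑ k ∈ Finset.range (2 ^ n), ∑' q : ℤ × (Fin d → ℤ),
    ENNReal.ofReal (
      (2 : ℝ) ^ (-(2 * (n : ℝ)) - (m : ℝ) * ((d : ℝ) + 2)) *
      (1 + |(q.1 : ℝ) / 2 ^ m|) ^ (-(2 : ℝ)) *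
      (1 + ‖(EuclideanSpace.equiv (Fin d) ℝ).symm (fun i => (q.2 i : ℝ) / 2 ^ m)‖) ^
        (-((d : ℝ) + 1)) *
      Real.exp (lam * 2 ^ n *
        (1 + ‖(EuclideanSpace.equiv (Fin d) ℝ).symm (fun i => (q.2 i : ℝ) / 2 ^ m)‖) ^ (1 / H) *
        ‖Yint w ((k : ℝ) / 2 ^ n) (((k : ℝ) + 1) / 2 ^ n) ((q.1 : ℝ) / 2 ^ m)
          ((EuclideanSpace.equiv (Fin d) ℝ).symm (fun i => (q.2 i : ℝ) / 2 ^ m))‖ ^ 2))) ^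
  (1 / lam)

/-- `Q^w_λ = √(log S^w_λ) + √(log R^w_λ)`. -/
def Qconst {d : ℕ} (H lam : ℝ) (w : ℝ → Euc d) : ℝ :=
  Real.sqrt (Real.log (Sconst H lam w).toReal) + Real.sqrt (Real.log (Rconst lam w).toReal)

/-- Sewing bound: if the additivity defect of `A` on `[a, c]` is at most `K (c - a) ^ θ`, then the
sum of `A` along a chain differs from its value on the whole interval by at most
`C (length) ^ θ`. -/
lemma norm_sum_chain_sub_le {W : Type*} [NormedAddCommGroup W] {I : Set ℝ} (hI : I.OrdConnected)
    {A : ℝ → ℝ → W} {K C θ : ℝ} (hC : 0 ≤ C) (hθ : 0 ≤ θ)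
    (hKC : 2 * K + 2 * (C * (1 / 2 : ℝ) ^ θ) ≤ C) (hK : 0 ≤ K)
    (hself : ∀ a ∈ I, A a a = 0)
    (hA : ∀ a ∈ I, ∀ b ∈ I, ∀ c ∈ I, a ≤ b → b ≤ c →
      ‖A a b + A b c - A a c‖ ≤ K * (c - a) ^ θ) (n : ℕ) :
    ∀ p : ℕ → ℝ, Monotone p → p 0 ∈ I → p n ∈ I →
      ‖∑ i ∈ Finset.range n, A (p i) (p (i + 1)) - A (p 0) (p n)‖ ≤ C * (p n - p 0) ^ θ := by
  induction n using Nat.strong_induction_on with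
  | _ n ih =>
  intro p hp h0 hn
  rcases n with _ | n
  · simpa [hself _ h0] using mul_nonneg hC (Real.rpow_nonneg le_rfl θ)
  have hmem : ∀ i ≤ n + 1, p i ∈ I := fun i hi =>
    hI.out h0 hn ⟨hp (Nat.zero_le i), hp hi⟩
  set l := p (n + 1) - p 0 with hl
  have hl0 : 0 ≤ l := sub_nonneg.2 (hp (Nat.zero_le _))
  obtain ⟨j, hjn, hleft, hright⟩ :
      ∃ j ≤ n, p j - p 0 ≤ l / 2 ∧ p (n + 1) - p (j + 1) ≤ l / 2 := by
    classical
    let Q : ℕ → Prop := fun k => p k - p 0 ≤ l / 2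
    have hQ0 : Q 0 := by simp only [Q, sub_self]; positivity
    refine ⟨Nat.findGreatest Q n, Nat.findGreatest_le n,
      Nat.findGreatest_spec (P := Q) (Nat.zero_le n) hQ0, ?_⟩
    rcases (Nat.findGreatest_le (P := Q) n).eq_or_lt with h | h
    · rw [h, sub_self]; positivity
    · have : ¬ Q (Nat.findGreatest Q n + 1) :=
        Nat.findGreatest_is_greatest (Nat.lt_succ_self _) h
      simp only [Q, not_le] at this
      linarith
  obtain ⟨m, rfl⟩ := Nat.exists_eq_add_of_le hjn
  have hidx : j + m + 1 = j + 1 + m := by ring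
  have hL := ih j (by omega) p hp h0 (hmem j (by omega))
  have hR := ih m (by omega) (fun i => p (j + 1 + i))
    (fun a b hab => hp (by omega)) (hmem _ (by omega)) (hmem _ (by omega))
  simp only [add_zero, ← hidx] at hR
  have hhalf : ∀ x, 0 ≤ x → x ≤ l / 2 → C * x ^ θ ≤ C * (1 / 2 : ℝ) ^ θ * l ^ θ := by
    intro x hx hxl
    rw [mul_assoc, ← Real.mul_rpow (by norm_num) hl0]
    exact mul_le_mul_of_nonneg_left (Real.rpow_le_rpow hx (by linarith) hθ) hC
  have hL' := hL.trans (hhalf _ (sub_nonneg.2 (hp (Nat.zero_le _))) hleft)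
  have hR' := hR.trans (hhalf _ (sub_nonneg.2 (hp (by omega))) hright)
  have hM₁ := hA (p 0) h0 (p j) (hmem _ (by omega)) (p (j + m + 1)) hn
    (hp (Nat.zero_le _)) (hp (by omega))
  have hM₂ := hA (p j) (hmem _ (by omega)) (p (j + 1)) (hmem _ (by omega)) (p (j + m + 1)) hn
    (hp (by omega)) (hp (by omega))
  have hM₂' : K * (p (j + m + 1) - p j) ^ θ ≤ K * l ^ θ :=
    mul_le_mul_of_nonneg_left (Real.rpow_le_rpow (sub_nonneg.2 (hp (by omega)))
      (by rw [hl]; linarith [hp (Nat.zero_le j)]) hθ) hK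
  have hsplit : ∑ i ∈ Finset.range (j + m + 1), A (p i) (p (i + 1)) - A (p 0) (p (j + m + 1)) =
      (∑ i ∈ Finset.range j, A (p i) (p (i + 1)) - A (p 0) (p j)) +
      (∑ i ∈ Finset.range m, A (p (j + 1 + i)) (p (j + 1 + (i + 1))) -
        A (p (j + 1)) (p (j + m + 1))) +
      (A (p 0) (p j) + A (p j) (p (j + m + 1)) - A (p 0) (p (j + m + 1))) +
      (A (p j) (p (j + 1)) + A (p (j + 1)) (p (j + m + 1)) - A (p j) (p (j + m + 1))) := by
    rw [show Finset.range (j + m + 1) = Finset.range (j + 1 + m) by rw [hidx],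
      Finset.sum_range_add, Finset.sum_range_succ]
    simp only [← add_assoc]
    abel
  rw [hsplit]
  calc _ ≤ _ := norm_add₄_le
    _ ≤ C * (1 / 2 : ℝ) ^ θ * l ^ θ + C * (1 / 2 : ℝ) ^ θ * l ^ θ + K * l ^ θ + K * l ^ θ := by
      gcongr
      exact hM₂.trans hM₂'
    _ = (2 * K + 2 * (C * (1 / 2 : ℝ) ^ θ)) * l ^ θ := by ring
    _ ≤ C * l ^ θ := by gcongr

/-- A function vanishing on the diagonal takes the same value on `[x, y]` clamped to `[a, b]` and
on `[a, b]` clamped to `[x, y]`. -/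
lemma apply_clamp_comm {W : Type*} [Zero W] {I : Set ℝ} {A : ℝ → ℝ → W}
    (hself : ∀ a ∈ I, A a a = 0) {a b x y : ℝ} (ha : a ∈ I) (hb : b ∈ I) (hx : x ∈ I)
    (hy : y ∈ I) (hab : a ≤ b) (hxy : x ≤ y) :
    A (max a (min b x)) (max a (min b y)) = A (max x (min y a)) (max x (min y b)) := by
  rcases le_total b x with h | h
  · rw [min_eq_left h, min_eq_left (h.trans hxy), max_eq_right hab,
      min_eq_right ((hab.trans h).trans hxy), min_eq_right (h.trans hxy),
      max_eq_left (hab.trans h), max_eq_left h, hself b hb, hself x hx]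
  rcases le_total y a with h' | h'
  · rw [min_eq_right h, min_eq_right (h'.trans hab), max_eq_left (hxy.trans h'), max_eq_left h',
      min_eq_left h', min_eq_left (h'.trans hab), max_eq_right hxy, hself a ha, hself y hy]
  · rw [min_eq_right h, min_eq_right h', max_comm a x, max_eq_right (le_min hab h'),
      max_eq_right (le_min hxy h), min_comm]

/-- A `θ`-power sum of increments of a chain of mesh at most `δ`. -/
lemma sum_rpow_increment_le {p : ℕ → ℝ} (hp : Monotone p) {δ θ : ℝ} (hθ : 1 ≤ θ) (n : ℕ)
    (hmesh : ∀ i < n, p (i + 1) - p i ≤ δ) :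
    ∑ i ∈ Finset.range n, (p (i + 1) - p i) ^ θ ≤ δ ^ (θ - 1) * (p n - p 0) := by
  rw [← Finset.sum_range_sub, Finset.mul_sum]
  refine Finset.sum_le_sum fun i hi => ?_
  have h0 : 0 ≤ p (i + 1) - p i := sub_nonneg.2 (hp (Nat.le_succ i))
  calc (p (i + 1) - p i) ^ θ = (p (i + 1) - p i) ^ (θ - 1) * (p (i + 1) - p i) := by
        rw [← Real.rpow_add_one' h0 (by linarith), sub_add_cancel]
    _ ≤ δ ^ (θ - 1) * (p (i + 1) - p i) := by
        gcongr
        exact hmesh i (Finset.mem_range.1 hi)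

/-- The sum of `A` along `p` is close to its sum along the common refinement of `p` and `q`. -/
lemma norm_sum_chain_sub_refinement_le {W : Type*} [NormedAddCommGroup W] {I : Set ℝ}
    (hI : I.OrdConnected) {A : ℝ → ℝ → W} {C δ θ : ℝ} (hC : 0 ≤ C) (hθ : 1 ≤ θ)
    (hsew : ∀ (n : ℕ) (p : ℕ → ℝ), Monotone p → p 0 ∈ I → p n ∈ I →
      ‖∑ i ∈ Finset.range n, A (p i) (p (i + 1)) - A (p 0) (p n)‖ ≤ C * (p n - p 0) ^ θ)
    {p q : ℕ → ℝ} {n m : ℕ} (hp : Monotone p) (hq : Monotone q) (h0 : p 0 ∈ I) (hn : p n ∈ I)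
    (hq0 : q 0 = p 0) (hqm : q m = p n) (hmesh : ∀ i < n, p (i + 1) - p i ≤ δ) :
    ‖∑ i ∈ Finset.range n, ∑ k ∈ Finset.range m,
        A (max (p i) (min (p (i + 1)) (q k))) (max (p i) (min (p (i + 1)) (q (k + 1)))) -
      ∑ i ∈ Finset.range n, A (p i) (p (i + 1))‖ ≤ C * (δ ^ (θ - 1) * (p n - p 0)) := by
  rw [← Finset.sum_sub_distrib]
  refine (norm_sum_le _ _).trans ?_
  refine le_trans (Finset.sum_le_sum fun i hi => ?_)
    ((Finset.mul_sum _ _ _).symm.le.trans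
      (mul_le_mul_of_nonneg_left (sum_rpow_increment_le hp hθ n hmesh) hC))
  have hin : i + 1 ≤ n := Finset.mem_range.1 hi
  have hii := hp (Nat.le_succ i)
  have hstart : max (p i) (min (p (i + 1)) (q 0)) = p i := by
    rw [hq0]
    exact max_eq_left ((min_le_right _ _).trans (hp (Nat.zero_le _)))
  have hend : max (p i) (min (p (i + 1)) (q m)) = p (i + 1) := by
    rw [hqm, min_eq_left (hp hin), max_eq_right hii]
  have := hsew m (fun k => max (p i) (min (p (i + 1)) (q k)))
    (fun a b hab => max_le_max le_rfl (min_le_min le_rfl (hq hab)))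
    (by rw [hstart]; exact hI.out h0 hn ⟨hp (Nat.zero_le _), hp (by omega)⟩)
    (by rw [hend]; exact hI.out h0 hn ⟨hp (Nat.zero_le _), hp hin⟩)
  rwa [hstart, hend] at this

/-- Sums along two chains of mesh at most `δ` with the same endpoints are close. -/
lemma norm_sum_chain_sub_sum_chain_le {W : Type*} [NormedAddCommGroup W] {I : Set ℝ}
    (hI : I.OrdConnected) {A : ℝ → ℝ → W} {C δ θ : ℝ} (hC : 0 ≤ C) (hθ : 1 ≤ θ)
    (hself : ∀ a ∈ I, A a a = 0)
    (hsew : ∀ (n : ℕ) (p : ℕ → ℝ), Monotone p → p 0 ∈ I → p n ∈ I →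
      ‖∑ i ∈ Finset.range n, A (p i) (p (i + 1)) - A (p 0) (p n)‖ ≤ C * (p n - p 0) ^ θ)
    {p q : ℕ → ℝ} {n m : ℕ} (hp : Monotone p) (hq : Monotone q) (h0 : p 0 ∈ I) (hn : p n ∈ I)
    (hq0 : q 0 = p 0) (hqm : q m = p n) (hpmesh : ∀ i < n, p (i + 1) - p i ≤ δ)
    (hqmesh : ∀ k < m, q (k + 1) - q k ≤ δ) :
    ‖∑ i ∈ Finset.range n, A (p i) (p (i + 1)) - ∑ k ∈ Finset.range m, A (q k) (q (k + 1))‖ ≤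
      2 * (C * (δ ^ (θ - 1) * (p n - p 0))) := by
  have hP := norm_sum_chain_sub_refinement_le hI hC hθ hsew hp hq h0 hn hq0 hqm hpmesh
  have hQ := norm_sum_chain_sub_refinement_le hI hC hθ hsew hq hp (hq0 ▸ h0) (hqm ▸ hn)
    hq0.symm hqm.symm hqmesh
  have hpI : ∀ i ≤ n, p i ∈ I := fun i hi => hI.out h0 hn ⟨hp (Nat.zero_le i), hp hi⟩
  have hqI : ∀ k ≤ m, q k ∈ I := fun k hk =>
    hI.out h0 hn ⟨hq0 ▸ hq (Nat.zero_le k), hqm ▸ hq hk⟩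
  rw [Finset.sum_comm, Finset.sum_congr rfl fun i hi => Finset.sum_congr rfl fun k hk =>
    apply_clamp_comm hself (hqI k (Finset.mem_range.1 hk).le) (hqI (k + 1) (Finset.mem_range.1 hk))
      (hpI i (Finset.mem_range.1 hi).le) (hpI (i + 1) (Finset.mem_range.1 hi))
      (hq (Nat.le_succ k)) (hp (Nat.le_succ i)), hq0, hqm] at hQ
  rw [← sub_sub_sub_cancel_left, two_mul]
  exact (norm_sub_le _ _).trans (add_le_add hQ hP)

/-- The points of a partition, frozen after the last one. -/
def IntervalPartition.chain {s t : ℝ} (P : IntervalPartition s t) (i : ℕ) : ℝ :=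
  P.pts (min i P.n)

lemma IntervalPartition.chain_of_le {s t : ℝ} (P : IntervalPartition s t) {i : ℕ}
    (hi : i ≤ P.n) : P.chain i = P.pts i := by
  rw [chain, min_eq_left hi]

lemma IntervalPartition.chain_zero {s t : ℝ} (P : IntervalPartition s t) : P.chain 0 = s := by
  rw [P.chain_of_le (Nat.zero_le _), P.first]

lemma IntervalPartition.chain_n {s t : ℝ} (P : IntervalPartition s t) : P.chain P.n = t := by
  rw [P.chain_of_le le_rfl, P.last]

lemma IntervalPartition.chain_monotone {s t : ℝ} (P : IntervalPartition s t) :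
    Monotone P.chain := by
  refine monotone_nat_of_le_succ fun i => ?_
  rcases lt_or_ge i P.n with h | h
  · rw [P.chain_of_le h.le, P.chain_of_le h]
    exact P.mono i h
  · rw [chain, chain, min_eq_right h, min_eq_right (h.trans (Nat.le_succ i))]

lemma riemannSum_eq_sum_chain {V W : Type*} [AddCommGroup W] (G : ℝ → V → W) (f : ℝ → V)
    {s t : ℝ} (P : IntervalPartition s t) :
    RiemannSum G f P = ∑ i ∈ Finset.range P.n,
      (G (P.chain (i + 1)) (f (P.chain i)) - G (P.chain i) (f (P.chain i))) := by
  refine Finset.sum_congr rfl fun i hi => ?_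
  have hi := Finset.mem_range.1 hi
  rw [P.chain_of_le hi, P.chain_of_le hi.le]

/-- The uniform partition of `[s, t]` into `N + 1` pieces. -/
def uniformPartition {s t : ℝ} (hst : s ≤ t) (N : ℕ) : IntervalPartition s t where
  n := N + 1
  pts i := s + i * ((t - s) / (N + 1))
  first := by simp
  last := by push_cast; field_simp; ring
  mono i _ := by
    have : 0 ≤ (t - s) / ((N : ℝ) + 1) := div_nonneg (sub_nonneg.2 hst) (by positivity)
    push_cast
    nlinarith

lemma eventually_uniformPartition_meshLt {s t : ℝ} (hst : s ≤ t) {δ : ℝ} (hδ : 0 < δ) :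
    ∀ᶠ N in atTop, (uniformPartition hst N).MeshLt δ := by
  have hlim : Tendsto (fun N : ℕ => (t - s) * (1 / ((N : ℝ) + 1))) atTop (𝓝 0) := by
    simpa using tendsto_one_div_add_atTop_nhds_zero_nat.const_mul (t - s)
  filter_upwards [hlim.eventually_lt_const hδ] with N hN i _
  simp only [uniformPartition]
  push_cast
  calc _ = (t - s) * (1 / ((N : ℝ) + 1)) := by ring
    _ < δ := hN

lemma HasYoungIntegral.tendsto_uniformPartition {V W : Type*} [NormedAddCommGroup W]
    {G : ℝ → V → W} {f : ℝ → V} {s t : ℝ} (hst : s ≤ t) {L : W}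
    (h : HasYoungIntegral G f s t L) :
    Tendsto (fun N => RiemannSum G f (uniformPartition hst N)) atTop (𝓝 L) := by
  refine Metric.tendsto_nhds.2 fun ε hε => ?_
  obtain ⟨δ, hδ, hP⟩ := h ε hε
  filter_upwards [eventually_uniformPartition_meshLt hst hδ] with N hN
  rw [dist_eq_norm]
  exact hP _ hN

/-- Concatenation of two partitions. -/
def IntervalPartition.append {s u t : ℝ} (P : IntervalPartition s u)
    (Q : IntervalPartition u t) : IntervalPartition s t where
  n := P.n + Q.n
  pts i := if i ≤ P.n then P.pts i else Q.pts (i - P.n)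
  first := by simp [P.first]
  last := by
    rcases Nat.eq_zero_or_pos Q.n with h | h
    · simp only [h, add_zero, le_refl, if_true, P.last]
      rw [← Q.first, ← h, Q.last]
    · rw [if_neg (by omega), Nat.add_sub_cancel_left, Q.last]
  mono i hi := by
    rcases lt_trichotomy i P.n with h | h | h
    · rw [if_pos h.le, if_pos (Nat.succ_le_of_lt h)]
      exact P.mono i h
    · subst h
      rw [if_pos le_rfl, if_neg (by omega), Nat.add_sub_cancel_left, P.last]
      exact Q.first.symm.le.trans (Q.mono 0 (by omega))
    · rw [if_neg (by omega), if_neg (by omega), Nat.sub_add_comm h.le]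
      exact Q.mono _ (by omega)

lemma IntervalPartition.append_pts_of_le {s u t : ℝ} (P : IntervalPartition s u)
    (Q : IntervalPartition u t) {i : ℕ} (hi : i ≤ P.n) : (P.append Q).pts i = P.pts i :=
  if_pos hi

lemma IntervalPartition.append_pts_add {s u t : ℝ} (P : IntervalPartition s u)
    (Q : IntervalPartition u t) (i : ℕ) : (P.append Q).pts (P.n + i) = Q.pts i := by
  rcases Nat.eq_zero_or_pos i with rfl | h
  · rw [add_zero, P.append_pts_of_le Q le_rfl, P.last, Q.first]
  · simp only [append]
    rw [if_neg (by omega), Nat.add_sub_cancel_left]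

lemma IntervalPartition.MeshLt.append {s u t δ : ℝ} {P : IntervalPartition s u}
    {Q : IntervalPartition u t} (hP : P.MeshLt δ) (hQ : Q.MeshLt δ) : (P.append Q).MeshLt δ := by
  intro i hi
  rcases lt_or_ge i P.n with h | h
  · rw [P.append_pts_of_le Q h.le, P.append_pts_of_le Q h]
    exact hP i h
  · obtain ⟨k, rfl⟩ := Nat.exists_eq_add_of_le h
    rw [add_assoc, P.append_pts_add, P.append_pts_add]
    exact hQ k (Nat.lt_of_add_lt_add_left hi)

lemma riemannSum_append {V W : Type*} [AddCommGroup W] (G : ℝ → V → W) (f : ℝ → V)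
    {s u t : ℝ} (P : IntervalPartition s u) (Q : IntervalPartition u t) :
    RiemannSum G f (P.append Q) = RiemannSum G f P + RiemannSum G f Q := by
  unfold RiemannSum
  rw [show (P.append Q).n = P.n + Q.n from rfl, Finset.sum_range_add]
  congr 1
  · refine Finset.sum_congr rfl fun i hi => ?_
    have hi := Finset.mem_range.1 hi
    rw [P.append_pts_of_le Q hi, P.append_pts_of_le Q hi.le]
  · simp only [add_assoc, P.append_pts_add]

/-- Cauchy criterion for the existence of the nonlinear Young integral. -/
lemma exists_hasYoungIntegral_of_cauchy {V W : Type*} [NormedAddCommGroup W] [CompleteSpace W]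
    {G : ℝ → V → W} {f : ℝ → V} {s t : ℝ} (hst : s ≤ t)
    (h : ∀ ε > 0, ∃ δ > 0, ∀ P Q : IntervalPartition s t, P.MeshLt δ → Q.MeshLt δ →
      ‖RiemannSum G f P - RiemannSum G f Q‖ < ε) :
    ∃ L, HasYoungIntegral G f s t L := by
  have hcauchy : CauchySeq fun N => RiemannSum G f (uniformPartition hst N) := by
    refine Metric.cauchySeq_iff.2 fun ε hε => ?_
    obtain ⟨δ, hδ, hPQ⟩ := h ε hε
    obtain ⟨N, hN⟩ := eventually_atTop.1 (eventually_uniformPartition_meshLt hst hδ)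
    exact ⟨N, fun m hm n hn => by rw [dist_eq_norm]; exact hPQ _ _ (hN m hm) (hN n hn)⟩
  obtain ⟨L, hL⟩ := cauchySeq_tendsto_of_complete hcauchy
  refine ⟨L, fun ε hε => ?_⟩
  obtain ⟨δ, hδ, hPQ⟩ := h (ε / 2) (half_pos hε)
  refine ⟨δ, hδ, fun P hP => lt_of_le_of_lt ?_ (half_lt_self hε)⟩
  refine le_of_tendsto (hL.const_sub (RiemannSum G f P)).norm ?_
  filter_upwards [eventually_uniformPartition_meshLt hst hδ] with N hN using (hPQ P _ hP hN).le

/-- The additivity defect of the local approximation `(G_b - G_a)(f_a)`. -/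
lemma norm_young_defect_le {V W : Type*} [NormedAddCommGroup V] [NormedAddCommGroup W]
    {ν ρ ϑ : ℝ} (hν : 0 < ν) (hρ : 0 < ρ) (hϑ : 0 < ϑ) {I : Set ℝ}
    {G : ℝ → V → W} {f : ℝ → V} {CG Cf : ℝ}
    (hG : ∀ s ∈ I, ∀ t ∈ I, ∀ u v : V,
      ‖(G t u - G s u) - (G t v - G s v)‖ ≤ CG * |t - s| ^ ν * ‖u - v‖ ^ ϑ)
    (hf : ∀ s ∈ I, ∀ t ∈ I, ‖f t - f s‖ ≤ Cf * |t - s| ^ ρ)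
    {a b c : ℝ} (ha : a ∈ I) (hb : b ∈ I) (hc : c ∈ I) (hab : a ≤ b) (hbc : b ≤ c) :
    ‖(G b (f a) - G a (f a)) + (G c (f b) - G b (f b)) - (G c (f a) - G a (f a))‖ ≤
      |CG| * |Cf| ^ ϑ * (c - a) ^ (ν + ϑ * ρ) := by
  have hca : 0 ≤ c - a := by linarith
  have hfab : ‖f b - f a‖ ^ ϑ ≤ |Cf| ^ ϑ * (c - a) ^ (ϑ * ρ) := by
    rw [mul_comm ϑ ρ, Real.rpow_mul hca, ← Real.mul_rpow (abs_nonneg _) (Real.rpow_nonneg hca _)]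
    refine Real.rpow_le_rpow (norm_nonneg _) ((hf a ha b hb).trans ?_) hϑ.le
    rw [abs_of_nonneg (sub_nonneg.2 hab)]
    exact mul_le_mul (le_abs_self _)
      (Real.rpow_le_rpow (sub_nonneg.2 hab) (by linarith) hρ.le)
      (Real.rpow_nonneg (sub_nonneg.2 hab) _) (abs_nonneg _)
  calc _ = ‖(G c (f b) - G b (f b)) - (G c (f a) - G b (f a))‖ := by congr 1; abel
    _ ≤ CG * |c - b| ^ ν * ‖f b - f a‖ ^ ϑ := hG b hb c hc _ _
    _ ≤ |CG| * (c - a) ^ ν * (|Cf| ^ ϑ * (c - a) ^ (ϑ * ρ)) := by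
      rw [abs_of_nonneg (sub_nonneg.2 hbc)]
      refine mul_le_mul (mul_le_mul (le_abs_self _)
        (Real.rpow_le_rpow (sub_nonneg.2 hbc) (by linarith) hν.le)
        (Real.rpow_nonneg (sub_nonneg.2 hbc) _) (abs_nonneg _)) hfab (by positivity)
        (by positivity)
    _ = |CG| * |Cf| ^ ϑ * (c - a) ^ (ν + ϑ * ρ) := by
      rw [Real.rpow_add_of_nonneg hca hν.le (by positivity)]
      ring

/-- Existence of the nonlinear Young integral `∫_s^t G_{du}(f_u)` as a
limit of Riemann sums for `G ∈ C^{0,ν}(I, C^{0,ϑ}(V,W))`, `f ∈ C^{0,ρ}(I,V)`,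
`ν + ϑρ > 1`, together with the uniqueness of the limit and the Chasles relation. -/
theorem statement1 {V W : Type*} [NormedAddCommGroup V] [NormedAddCommGroup W]
    [CompleteSpace W]
    (ν ρ ϑ : ℝ) (hν : 0 < ν) (hν1 : ν ≤ 1) (hρ : 0 < ρ) (hρ1 : ρ ≤ 1)
    (hϑ : 0 < ϑ) (hϑ1 : ϑ ≤ 1) (h1 : 1 < ν + ϑ * ρ)
    (I : Set ℝ) (hI : I.OrdConnected)
    (G : ℝ → V → W) (f : ℝ → V) (CG Cf : ℝ)
    (hG : ∀ s ∈ I, ∀ t ∈ I, ∀ u v : V,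
      ‖(G t u - G s u) - (G t v - G s v)‖ ≤ CG * |t - s| ^ ν * ‖u - v‖ ^ ϑ)
    (hf : ∀ s ∈ I, ∀ t ∈ I, ‖f t - f s‖ ≤ Cf * |t - s| ^ ρ) :
    (∀ s ∈ I, ∀ t ∈ I, s ≤ t → ∃ L : W, HasYoungIntegral G f s t L) ∧
    (∀ s ∈ I, ∀ t ∈ I, s ≤ t → ∀ L L' : W,
      HasYoungIntegral G f s t L → HasYoungIntegral G f s t L' → L = L') ∧
    (∀ s ∈ I, ∀ u ∈ I, ∀ t ∈ I, s ≤ u → u ≤ t →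
      ∀ L₁ L₂ L : W, HasYoungIntegral G f s u L₁ → HasYoungIntegral G f u t L₂ →
        HasYoungIntegral G f s t L → L = L₁ + L₂) := by
  set θ := ν + ϑ * ρ with hθ
  set K := |CG| * |Cf| ^ ϑ with hKdef
  have hK : 0 ≤ K := by positivity
  have hhalf : (1 / 2 : ℝ) ^ θ < 1 / 2 := by
    simpa using Real.rpow_lt_rpow_of_exponent_gt (by norm_num : (0 : ℝ) < 1 / 2) (by norm_num) h1
  obtain ⟨C, hC, hKC⟩ : ∃ C : ℝ, 0 ≤ C ∧ 2 * K + 2 * (C * (1 / 2 : ℝ) ^ θ) ≤ C := by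
    have hpos : 0 < 1 - 2 * (1 / 2 : ℝ) ^ θ := by linarith
    refine ⟨2 * K / (1 - 2 * (1 / 2 : ℝ) ^ θ), by positivity, le_of_eq ?_⟩
    field_simp
    ring
  let A : ℝ → ℝ → W := fun a b => G b (f a) - G a (f a)
  have hself : ∀ a ∈ I, A a a = 0 := fun a _ => sub_self _
  have hsew := norm_sum_chain_sub_le (A := A) hI hC (by linarith) hKC hK hself
    fun a ha b hb c hc hab hbc => norm_young_defect_le hν hρ hϑ hG hf ha hb hc hab hbc
  refine ⟨fun s hs t ht hst => ?_, fun s _ t _ hst L L' hL hL' => ?_,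
    fun s _ u _ t _ hsu hut L₁ L₂ L h₁ h₂ hL => ?_⟩
  · refine exists_hasYoungIntegral_of_cauchy hst fun ε hε => ?_
    have hlim : Tendsto (fun δ : ℝ => 2 * (C * (δ ^ (θ - 1) * (t - s)))) (𝓝[>] 0) (𝓝 0) := by
      have hpow : Tendsto (fun δ : ℝ => δ ^ (θ - 1)) (𝓝[>] 0) (𝓝 0) := by
        have := (Real.continuousAt_rpow_const 0 (θ - 1) (Or.inr (by linarith))).tendsto
        rw [Real.zero_rpow (by linarith)] at this
        exact this.mono_left nhdsWithin_le_nhds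
      simpa using ((hpow.mul_const (t - s)).const_mul C).const_mul 2
    obtain ⟨δ, hδε, hδ⟩ := ((hlim.eventually_lt_const hε).and self_mem_nhdsWithin).exists
    refine ⟨δ, hδ, fun P Q hP hQ => lt_of_le_of_lt ?_ hδε⟩
    have hmesh : ∀ R : IntervalPartition s t, R.MeshLt δ →
        ∀ i < R.n, R.chain (i + 1) - R.chain i ≤ δ := fun R hR i hi => by
      rw [R.chain_of_le hi, R.chain_of_le hi.le]
      exact (hR i hi).le
    have := norm_sum_chain_sub_sum_chain_le (A := A) hI hC h1.le hself hsew
      P.chain_monotone Q.chain_monotone (by rwa [P.chain_zero]) (by rwa [P.chain_n])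
      (by rw [P.chain_zero, Q.chain_zero]) (by rw [P.chain_n, Q.chain_n]) (hmesh P hP)
      (hmesh Q hQ)
    rw [P.chain_zero, P.chain_n] at this
    rwa [riemannSum_eq_sum_chain, riemannSum_eq_sum_chain]
  · exact tendsto_nhds_unique (hL.tendsto_uniformPartition hst) (hL'.tendsto_uniformPartition hst)
  · have hsum := (h₁.tendsto_uniformPartition hsu).add (h₂.tendsto_uniformPartition hut)
    refine tendsto_nhds_unique (Metric.tendsto_nhds.2 fun ε hε => ?_) hsum
    obtain ⟨δ, hδ, hP⟩ := hL ε hε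
    filter_upwards [eventually_uniformPartition_meshLt hsu hδ,
      eventually_uniformPartition_meshLt hut hδ] with N hN hN'
    rw [dist_eq_norm, ← riemannSum_append]
    exact hP _ (hN.append hN')
end
end

section
/- Let ν, ρ, ϑ > 0 with ν + ϑρ > 1, let V and W be Banach spaces, I ⊆ ℝ an interval, G ∈ C^{0,ν}(I, C^{0,ϑ}(V,W)) and f ∈ C^{0,ρ}(I,V). There is a constant C depending only on ν, ρ, ϑ such that for all s ≤ t in I: ‖∫_s^t G_{dr}(f_r) − (G_t − G_s)(f_s)‖_W ≤ C ‖G‖_{ν,I} ‖f‖_{ρ,I}^ϑ |t−s|^{ν+ϑρ}. -/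
open MeasureTheory Filter Topology
open scoped ENNReal NNReal

noncomputable section

/-- The Riemann sum of a two-parameter function over the uniform partition of `[s, t]` into
`2 ^ k` pieces. -/
def dyadicSum {W : Type*} [AddCommMonoid W] (A : ℝ → ℝ → W) (k : ℕ) (s t : ℝ) : W :=
  ∑ i ∈ Finset.range (2 ^ k),
    A (s + (i : ℝ) * ((t - s) / 2 ^ k)) (s + ((i + 1 : ℕ) : ℝ) * ((t - s) / 2 ^ k))

theorem dyadicSum_zero {W : Type*} [AddCommMonoid W] (A : ℝ → ℝ → W) (s t : ℝ) :
    dyadicSum A 0 s t = A s t := by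
  simp [dyadicSum]

theorem dyadicSum_succ {W : Type*} [AddCommMonoid W] (A : ℝ → ℝ → W) (k : ℕ) (s t : ℝ) :
    dyadicSum A (k + 1) s t =
      dyadicSum A k s ((s + t) / 2) + dyadicSum A k ((s + t) / 2) t := by
  unfold dyadicSum
  rw [show 2 ^ (k + 1) = 2 ^ k + 2 ^ k by ring, Finset.sum_range_add]
  congr 1 <;> refine Finset.sum_congr rfl fun i _ => ?_ <;> congr 1 <;> push_cast <;>
    field_simp <;> ring

/-- Sewing estimate along dyadic partitions: a defect of order `γ > 1` of additivity at midpoints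
controls the distance of the dyadic sums from the germ. -/
theorem norm_dyadicSum_sub_le {W : Type*} [NormedAddCommGroup W] {γ M : ℝ} (hγ : 1 < γ)
    (A : ℝ → ℝ → W) {I : Set ℝ} (hI : I.OrdConnected)
    (hA : ∀ s ∈ I, ∀ t ∈ I, s ≤ t →
      ‖A s ((s + t) / 2) + A ((s + t) / 2) t - A s t‖ ≤ M * ((t - s) / 2) ^ γ)
    (hM : 0 ≤ M) (k : ℕ) :
    ∀ s ∈ I, ∀ t ∈ I, s ≤ t →
      ‖dyadicSum A k s t - A s t‖ ≤ (2 ^ γ - 2)⁻¹ * M * (t - s) ^ γ := by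
  have hpow : (2 : ℝ) < 2 ^ γ := by
    simpa using Real.rpow_lt_rpow_of_exponent_lt (x := 2) one_lt_two hγ
  have hK : (0 : ℝ) < 2 ^ γ - 2 := sub_pos.2 hpow
  induction k with
  | zero =>
    intro s _ t _ hst
    have : 0 ≤ t - s := sub_nonneg.2 hst
    rw [dyadicSum_zero, sub_self, norm_zero]
    positivity
  | succ k ih =>
    intro s hs t ht hst
    have hsm : s ≤ (s + t) / 2 := by linarith
    have hmt : (s + t) / 2 ≤ t := by linarith
    have hm : (s + t) / 2 ∈ I := hI.out hs ht ⟨hsm, hmt⟩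
    have h₁ := ih s hs _ hm hsm
    have h₂ := ih _ hm t ht hmt
    have h₃ := hA s hs t ht hst
    rw [show (s + t) / 2 - s = (t - s) / 2 by ring] at h₁
    rw [show t - (s + t) / 2 = (t - s) / 2 by ring] at h₂
    have hhalf : (t - s) ^ γ = 2 ^ γ * ((t - s) / 2) ^ γ := by
      rw [← Real.mul_rpow two_pos.le (by linarith)]
      congr 1
      ring
    rw [dyadicSum_succ, show
      dyadicSum A k s ((s + t) / 2) + dyadicSum A k ((s + t) / 2) t - A s t =
        (dyadicSum A k s ((s + t) / 2) - A s ((s + t) / 2)) +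
        (dyadicSum A k ((s + t) / 2) t - A ((s + t) / 2) t) +
        (A s ((s + t) / 2) + A ((s + t) / 2) t - A s t) by abel]
    refine norm_add₃_le.trans ((add_le_add (add_le_add h₁ h₂) h₃).trans (le_of_eq ?_))
    rw [hhalf]
    field_simp
    ring

/-- The uniform partition of `[s, t]` into `2 ^ k` pieces. -/
def dyadicPartition (s t : ℝ) (hst : s ≤ t) (k : ℕ) : IntervalPartition s t where
  n := 2 ^ k
  pts i := s + (i : ℝ) * ((t - s) / 2 ^ k)
  first := by simp
  last := by
    push_cast
    field_simp
    ring
  mono i _ := by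
    have : 0 ≤ (t - s) / 2 ^ k := div_nonneg (sub_nonneg.2 hst) (by positivity)
    push_cast
    linarith

theorem exists_meshLt_dyadicPartition {s t δ : ℝ} (hst : s ≤ t) (hδ : 0 < δ) :
    ∃ k, (dyadicPartition s t hst k).MeshLt δ := by
  obtain ⟨k, hk⟩ := pow_unbounded_of_one_lt ((t - s) / δ) one_lt_two
  refine ⟨k, fun i _ => ?_⟩
  have h : (t - s) / 2 ^ k < δ := by
    rw [div_lt_iff₀ (by positivity)]
    rw [div_lt_iff₀ hδ] at hk
    linarith
  simp only [dyadicPartition]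
  push_cast
  linarith

theorem HasYoungIntegral.norm_sub_le {V W : Type*} [NormedAddCommGroup W] {G : ℝ → V → W}
    {f : ℝ → V} {s t B : ℝ} {L a : W} (hst : s ≤ t) (hL : HasYoungIntegral G f s t L)
    (hB : ∀ k, ‖RiemannSum G f (dyadicPartition s t hst k) - a‖ ≤ B) : ‖L - a‖ ≤ B := by
  refine le_of_forall_pos_le_add fun ε hε => ?_
  obtain ⟨δ, hδ, hP⟩ := hL ε hε
  obtain ⟨k, hk⟩ := exists_meshLt_dyadicPartition hst hδ
  have h₁ := hP _ hk
  rw [norm_sub_rev] at h₁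
  have h₂ := norm_sub_le_norm_sub_add_norm_sub L (RiemannSum G f (dyadicPartition s t hst k)) a
  linarith [hB k]

/-- The germ `(G_t - G_s)(f_s)` of the nonlinear Young integral is almost additive. -/
theorem norm_youngGerm_defect_le {V W : Type*} [NormedAddCommGroup V] [NormedAddCommGroup W]
    {ν ρ ϑ CG Cf : ℝ} (hν : 0 < ν) (hρ : 0 < ρ) (hϑ : 0 < ϑ) (hCG : 0 ≤ CG) (hCf : 0 ≤ Cf)
    {I : Set ℝ} (hI : I.OrdConnected) {G : ℝ → V → W} {f : ℝ → V}
    (hG : ∀ s ∈ I, ∀ t ∈ I, ∀ u v : V,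
      ‖(G t u - G s u) - (G t v - G s v)‖ ≤ CG * |t - s| ^ ν * ‖u - v‖ ^ ϑ)
    (hf : ∀ s ∈ I, ∀ t ∈ I, ‖f t - f s‖ ≤ Cf * |t - s| ^ ρ)
    {s t : ℝ} (hs : s ∈ I) (ht : t ∈ I) (hst : s ≤ t) :
    ‖(G ((s + t) / 2) (f s) - G s (f s)) +
      (G t (f ((s + t) / 2)) - G ((s + t) / 2) (f ((s + t) / 2))) - (G t (f s) - G s (f s))‖ ≤
      CG * Cf ^ ϑ * ((t - s) / 2) ^ (ν + ϑ * ρ) := by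
  have hm : (s + t) / 2 ∈ I := hI.out hs ht ⟨by linarith, by linarith⟩
  have h : 0 ≤ (t - s) / 2 := by linarith
  have h₁ := hG _ hm t ht (f ((s + t) / 2)) (f s)
  have h₂ := hf s hs _ hm
  rw [show t - (s + t) / 2 = (t - s) / 2 by ring, abs_of_nonneg h] at h₁
  rw [show (s + t) / 2 - s = (t - s) / 2 by ring, abs_of_nonneg h] at h₂
  calc _ = ‖(G t (f ((s + t) / 2)) - G ((s + t) / 2) (f ((s + t) / 2))) -
          (G t (f s) - G ((s + t) / 2) (f s))‖ := by
        congr 1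
        abel
    _ ≤ CG * ((t - s) / 2) ^ ν * ‖f ((s + t) / 2) - f s‖ ^ ϑ := h₁
    _ ≤ CG * ((t - s) / 2) ^ ν * (Cf * ((t - s) / 2) ^ ρ) ^ ϑ := by gcongr
    _ = CG * Cf ^ ϑ * ((t - s) / 2) ^ (ν + ϑ * ρ) := by
        rw [Real.mul_rpow hCf (by positivity), ← Real.rpow_mul h, mul_comm ρ ϑ,
          Real.rpow_add_of_nonneg h hν.le (by positivity)]
        ring

/-- Quantitative bound for the nonlinear Young integral: there is a
constant `C` depending only on `ν, ρ, ϑ` such that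
`‖∫_s^t G_{dr}(f_r) − (G_t − G_s)(f_s)‖ ≤ C ‖G‖_{ν,I} ‖f‖_{ρ,I}^ϑ |t−s|^{ν+ϑρ}`. -/
theorem statement2 (ν ρ ϑ : ℝ) (hν : 0 < ν) (hν1 : ν ≤ 1) (hρ : 0 < ρ) (hρ1 : ρ ≤ 1)
    (hϑ : 0 < ϑ) (hϑ1 : ϑ ≤ 1) (h1 : 1 < ν + ϑ * ρ) :
    ∃ C : ℝ, 0 < C ∧
      ∀ (V W : Type) [NormedAddCommGroup V] [NormedAddCommGroup W],
      ∀ I : Set ℝ, I.OrdConnected →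
      ∀ (G : ℝ → V → W) (f : ℝ → V) (CG Cf : ℝ), 0 ≤ CG → 0 ≤ Cf →
      (∀ s ∈ I, ∀ t ∈ I, ∀ u v : V,
        ‖(G t u - G s u) - (G t v - G s v)‖ ≤ CG * |t - s| ^ ν * ‖u - v‖ ^ ϑ) →
      (∀ s ∈ I, ∀ t ∈ I, ‖f t - f s‖ ≤ Cf * |t - s| ^ ρ) →
      ∀ s ∈ I, ∀ t ∈ I, s ≤ t → ∀ L : W, HasYoungIntegral G f s t L →
        ‖L - (G t (f s) - G s (f s))‖ ≤ C * CG * Cf ^ ϑ * |t - s| ^ (ν + ϑ * ρ) := by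
  refine ⟨(2 ^ (ν + ϑ * ρ) - 2)⁻¹, inv_pos.2 (sub_pos.2 ?_), ?_⟩
  · simpa using Real.rpow_lt_rpow_of_exponent_lt (x := 2) one_lt_two h1
  intro V W _ _ I hI G f CG Cf hCG hCf hG hf s hs t ht hst L hL
  refine hL.norm_sub_le hst fun k => ?_
  have key := norm_dyadicSum_sub_le h1 (fun a b => G b (f a) - G a (f a)) hI
    (fun a ha b hb hab => norm_youngGerm_defect_le hν hρ hϑ hCG hCf hI hG hf ha hb hab)
    (by positivity) k s hs t ht hst
  rw [abs_of_nonneg (sub_nonneg.2 hst), mul_assoc (_⁻¹) CG]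
  exact key
end
end

section
/- Let α ∈ ℝ, γ ∈ (1/2,1], let w : [0,1] → ℝ^d be continuous with K^w_{α,γ} < ∞, let b ∈ FL^{α+1} and x₀ ∈ ℝ^d. Then there exists θ ∈ C^{0,γ}([0,1], ℝ^d) with θ₀ = x₀ solving the Young equation θ_t = x₀ + ∫₀^t (σ^w_{du} b)(θ_u) for all t ∈ [0,1]. -/
open MeasureTheory Filter Topology
open scoped ENNReal NNReal

noncomputable section

/-- The Euler scheme of step `1 / N` for the nonlinear Young equation driven by `G`. -/
def eulerScheme {E : Type*} [AddCommGroup E] (G : ℝ → E → E) (x₀ : E) (N : ℕ) : ℕ → E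
  | 0 => x₀
  | j + 1 => eulerScheme G x₀ N j +
      (G (((j + 1 : ℕ) : ℝ) / N) (eulerScheme G x₀ N j) - G ((j : ℝ) / N) (eulerScheme G x₀ N j))

/-- Davie's estimate for the Euler scheme, uniform in the step. -/
lemma eulerScheme_remainder_le {E : Type*} [NormedAddCommGroup E] {G : ℝ → E → E} {γ M S : ℝ}
    (hγ : 0 ≤ γ) (hM : 0 ≤ M) (hS : 0 ≤ S)
    (hC : (1 / 2 : ℝ) ^ (2 * γ) * S ^ 2 + 2 * M ^ 2 + M * S ≤ S ^ 2 / 2)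
    (hG : ∀ s t x, 0 ≤ s → s ≤ t → t ≤ 1 → ‖G t x - G s x‖ ≤ M * (t - s) ^ γ)
    (hL : ∀ s t x y, 0 ≤ s → s ≤ t → t ≤ 1 →
      ‖(G t x - G s x) - (G t y - G s y)‖ ≤ M * (t - s) ^ γ * ‖x - y‖)
    (x₀ : E) {N : ℕ} (hN : 0 < N) (n j : ℕ) (hj : j + n ≤ N) :
    ‖eulerScheme G x₀ N (j + n) - eulerScheme G x₀ N j -
      (G (((j + n : ℕ) : ℝ) / N) (eulerScheme G x₀ N j) - G ((j : ℝ) / N) (eulerScheme G x₀ N j))‖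
      ≤ S ^ 2 / 2 * ((n : ℝ) / N) ^ (2 * γ) := by
  induction n using Nat.strong_induction_on generalizing j with
  | _ n ih =>
  have hN' : (0 : ℝ) < N := by exact_mod_cast hN
  rcases Nat.eq_zero_or_pos n with rfl | hn
  · simp only [add_zero, sub_self, norm_zero]
    positivity
  set e := eulerScheme G x₀ N with he
  obtain ⟨a, b, hab, ha, hb⟩ : ∃ a b : ℕ, n = a + 1 + b ∧ 2 * a ≤ n ∧ 2 * b ≤ n :=
    ⟨n / 2, n - n / 2 - 1, by omega, by omega, by omega⟩
  have I1 := ih a (by omega) j (by omega)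
  have I2 := ih b (by omega) (j + a + 1) (by omega)
  set L : ℝ := (n : ℝ) / N with hLdef
  set l : ℝ := L ^ γ with hl
  have hLpos : 0 < L := by positivity
  have hl0 : 0 < l := Real.rpow_pos_of_pos hLpos _
  have hl2 : L ^ (2 * γ) = l ^ 2 := by
    rw [hl, mul_comm, Real.rpow_mul hLpos.le]; norm_cast
  have half : ∀ c : ℕ, 2 * c ≤ n → ((c : ℝ) / N) ^ (2 * γ) ≤ (1 / 2 : ℝ) ^ (2 * γ) * l ^ 2 := by
    intro c hc
    rw [← hl2, ← Real.mul_rpow (by norm_num) hLpos.le]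
    have : (2 * c : ℝ) ≤ n := by exact_mod_cast hc
    refine Real.rpow_le_rpow (by positivity) ?_ (by positivity)
    rw [hLdef, ← mul_div_assoc]
    gcongr
    linarith
  have grid : ∀ p q : ℕ, p ≤ q → q ≤ p + n → q ≤ N → 0 ≤ (p : ℝ) / N ∧ (p : ℝ) / N ≤ (q : ℝ) / N ∧
      (q : ℝ) / N ≤ 1 ∧ ((q : ℝ) / N - (p : ℝ) / N) ^ γ ≤ l := by
    intro p q h1 h2 h3
    have h1' : (p : ℝ) ≤ q := by exact_mod_cast h1
    have h2' : (q : ℝ) ≤ p + n := by exact_mod_cast h2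
    have h3' : (q : ℝ) ≤ N := by exact_mod_cast h3
    refine ⟨by positivity, by gcongr, (div_le_one hN').2 h3', ?_⟩
    rw [← sub_div]
    refine Real.rpow_le_rpow (div_nonneg (by linarith) hN'.le) ?_ hγ
    rw [hLdef]
    gcongr
    linarith
  have bd : ∀ (p q : ℕ) (x : E), p ≤ q → q ≤ p + n → q ≤ N →
      ‖G ((q : ℝ) / N) x - G ((p : ℝ) / N) x‖ ≤ M * l := fun p q x h1 h2 h3 => by
    obtain ⟨g1, g2, g3, g4⟩ := grid p q h1 h2 h3
    exact (hG _ _ _ g1 g2 g3).trans (by gcongr)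
  have lip : ∀ (p q : ℕ) (x y : E), p ≤ q → q ≤ p + n → q ≤ N →
      ‖(G ((q : ℝ) / N) x - G ((p : ℝ) / N) x) - (G ((q : ℝ) / N) y - G ((p : ℝ) / N) y)‖
        ≤ M * l * ‖x - y‖ := fun p q x y h1 h2 h3 => by
    obtain ⟨g1, g2, g3, g4⟩ := grid p q h1 h2 h3
    exact (hL _ _ _ _ g1 g2 g3).trans (by gcongr)
  have hstep : e (j + a + 1) = e (j + a) +
      (G (((j + a + 1 : ℕ) : ℝ) / N) (e (j + a)) - G (((j + a : ℕ) : ℝ) / N) (e (j + a))) := rfl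
  have hend : j + n = j + a + 1 + b := by omega
  set Δ₁ := (G (((j + n : ℕ) : ℝ) / N) (e (j + a)) - G (((j + a : ℕ) : ℝ) / N) (e (j + a)))
    - (G (((j + n : ℕ) : ℝ) / N) (e j) - G (((j + a : ℕ) : ℝ) / N) (e j)) with hΔ₁
  set Δ₂ := (G (((j + n : ℕ) : ℝ) / N) (e (j + a + 1)) -
      G (((j + a + 1 : ℕ) : ℝ) / N) (e (j + a + 1)))
    - (G (((j + n : ℕ) : ℝ) / N) (e (j + a)) - G (((j + a + 1 : ℕ) : ℝ) / N) (e (j + a))) with hΔ₂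
  rw [← hend] at I2
  have B1 := I1.trans (mul_le_mul_of_nonneg_left (half a ha) (by positivity))
  have B2 := I2.trans (mul_le_mul_of_nonneg_left (half b hb) (by positivity))
  have hD2 : ‖Δ₂‖ ≤ M ^ 2 * l ^ 2 := by
    refine (lip _ _ _ _ (by omega) (by omega) hj).trans ?_
    rw [hstep, add_sub_cancel_left]
    have := bd (j + a) (j + a + 1) (e (j + a)) (by omega) (by omega) (by omega)
    calc M * l * _ ≤ M * l * (M * l) := by gcongr
      _ = _ := by ring
  have hD1 : ‖Δ₁‖ ≤ (M ^ 2 + M * S) * l ^ 2 := by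
    rcases le_total (S * l) 2 with h | h
    · have hd : ‖e (j + a) - e j‖ ≤ M * l + S * l := by
        have h1 := bd j (j + a) (e j) (by omega) (by omega) (by omega)
        have h2 : ‖e (j + a) - e j‖ ≤ _ + _ := norm_le_norm_sub_add _
          (G (((j + a : ℕ) : ℝ) / N) (e j) - G ((j : ℝ) / N) (e j))
        have h3 : S ^ 2 / 2 * ((1 / 2 : ℝ) ^ (2 * γ) * l ^ 2) ≤ S * l := by
          have : (1 / 2 : ℝ) ^ (2 * γ) ≤ 1 :=
            Real.rpow_le_one (by norm_num) (by norm_num) (by positivity)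
          calc S ^ 2 / 2 * ((1 / 2 : ℝ) ^ (2 * γ) * l ^ 2) ≤ S ^ 2 / 2 * (1 * l ^ 2) := by gcongr
            _ = (S * l) * (S * l) / 2 := by ring
            _ ≤ (S * l) * 2 / 2 := by gcongr
            _ = S * l := by ring
        linarith
      refine (lip _ _ _ _ (by omega) (by omega) hj).trans ?_
      calc M * l * _ ≤ M * l * (M * l + S * l) := by gcongr
        _ = _ := by ring
    · have h1 := bd (j + a) (j + n) (e (j + a)) (by omega) (by omega) hj
      have h2 := bd (j + a) (j + n) (e j) (by omega) (by omega) hj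
      have h3 := norm_sub_le_of_le h1 h2
      have h4 : M * l * 2 ≤ M * l * (S * l) := by gcongr
      have h5 : 0 ≤ M ^ 2 * l ^ 2 := by positivity
      calc ‖Δ₁‖ ≤ _ := h3
        _ ≤ _ := by nlinarith
  have key : e (j + n) - e j - (G (((j + n : ℕ) : ℝ) / N) (e j) - G ((j : ℝ) / N) (e j)) =
      (e (j + a) - e j - (G (((j + a : ℕ) : ℝ) / N) (e j) - G ((j : ℝ) / N) (e j))) + Δ₁ +
      (e (j + n) - e (j + a + 1) - (G (((j + n : ℕ) : ℝ) / N) (e (j + a + 1)) -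
        G (((j + a + 1 : ℕ) : ℝ) / N) (e (j + a + 1)))) + Δ₂ := by
    rw [hΔ₁, hΔ₂, ← sub_eq_zero]
    refine Eq.trans ?_ (sub_eq_zero.2 hstep)
    abel
  rw [key, hl2]
  refine (norm_add_le_of_le (norm_add_le_of_le (norm_add_le_of_le B1 hD1) B2) hD2).trans ?_
  nlinarith [mul_le_mul_of_nonneg_right hC (sq_nonneg l)]

/-- Existence of a path whose increments are those of a nonlinear Young integral,
up to a remainder of order `2 * γ`. -/
lemma exists_path_remainder_le {E : Type*} [NormedAddCommGroup E] [ProperSpace E]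
    {G : ℝ → E → E} {γ M : ℝ} (hγ : 1 / 2 < γ) (hM : 0 ≤ M)
    (hG : ∀ s t x, 0 ≤ s → s ≤ t → t ≤ 1 → ‖G t x - G s x‖ ≤ M * (t - s) ^ γ)
    (hL : ∀ s t x y, 0 ≤ s → s ≤ t → t ≤ 1 →
      ‖(G t x - G s x) - (G t y - G s y)‖ ≤ M * (t - s) ^ γ * ‖x - y‖) (x₀ : E) :
    ∃ (θ : ℝ → E) (C : ℝ), 0 ≤ C ∧ θ 0 = x₀ ∧ ∀ s t, 0 ≤ s → s ≤ t → t ≤ 1 →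
      ‖θ t - θ s - (G t (θ s) - G s (θ s))‖ ≤ C * (t - s) ^ (2 * γ) := by
  have hγ0 : 0 < γ := by linarith
  have hr : (1 / 2 : ℝ) ^ (2 * γ) < 1 / 2 := by
    conv_rhs => rw [← Real.rpow_one (1 / 2 : ℝ)]
    exact Real.rpow_lt_rpow_of_exponent_gt (by norm_num) (by norm_num) (by linarith)
  have hr0 : (0 : ℝ) < (1 / 2 : ℝ) ^ (2 * γ) := by positivity
  obtain ⟨S, hS, hC⟩ : ∃ S : ℝ, 0 ≤ S ∧
      (1 / 2 : ℝ) ^ (2 * γ) * S ^ 2 + 2 * M ^ 2 + M * S ≤ S ^ 2 / 2 := by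
    set r : ℝ := (1 / 2 : ℝ) ^ (2 * γ)
    obtain ⟨q, hq⟩ : ∃ q, q = 1 / 2 - r := ⟨_, rfl⟩
    have hq0 : 0 < q := by linarith
    refine ⟨4 * M / q, by positivity, ?_⟩
    have h1 : q * (4 * M / q) ^ 2 = 16 * M ^ 2 / q := by field_simp; ring
    have h2 : M * (4 * M / q) = 4 * M ^ 2 / q := by field_simp
    have h3 : 2 * M ^ 2 ≤ 2 * M ^ 2 / q := by
      rw [le_div_iff₀ hq0]
      nlinarith [sq_nonneg M]
    have h4 : 0 ≤ M ^ 2 / q := by positivity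
    have h5 : r = 1 / 2 - q := by linarith
    rw [h5, h2]
    have h6 : (1 / 2 - q) * (4 * M / q) ^ 2 = (4 * M / q) ^ 2 / 2 - 16 * M ^ 2 / q := by
      rw [← h1]; ring
    rw [h6]
    have h7 : 16 * M ^ 2 / q = 16 * (M ^ 2 / q) := by ring
    have h8 : 4 * M ^ 2 / q = 4 * (M ^ 2 / q) := by ring
    have h9 : 2 * M ^ 2 / q = 2 * (M ^ 2 / q) := by ring
    linarith
  set C := S ^ 2 / 2
  have hC0 : 0 ≤ C := by positivity
  have hrem := fun (n : ℕ) => eulerScheme_remainder_le hγ0.le hM hS hC hG hL x₀ n.succ_pos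
  set e : ℕ → ℕ → E := fun n => eulerScheme G x₀ (n + 1) with he
  have he0 : ∀ n, e n 0 = x₀ := fun n => rfl
  let f : ℕ → ℝ → ℕ := fun n t => ⌊((n + 1 : ℕ) : ℝ) * t⌋₊
  let p : ℕ → ℝ → ℝ := fun n t => (f n t : ℝ) / ((n + 1 : ℕ) : ℝ)
  have hNpos : ∀ n : ℕ, (0 : ℝ) < ((n + 1 : ℕ) : ℝ) := fun n => by positivity
  have hp0 : ∀ n t, 0 ≤ p n t := fun n t => by positivity
  have hple : ∀ n t, 0 ≤ t → p n t ≤ t := fun n t ht => by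
    rw [div_le_iff₀ (hNpos n), mul_comm]
    exact Nat.floor_le (mul_nonneg (hNpos n).le ht)
  have hlep : ∀ n t, 0 ≤ t → t ≤ p n t + 1 / ((n + 1 : ℕ) : ℝ) := fun n t ht => by
    rw [← add_div, le_div_iff₀ (hNpos n), mul_comm]
    exact (Nat.lt_floor_add_one _).le
  have hfmono : ∀ n s t, s ≤ t → f n s ≤ f n t := fun n s t hst =>
    Nat.floor_le_floor (mul_le_mul_of_nonneg_left hst (hNpos n).le)
  have hfN : ∀ n t, t ≤ 1 → f n t ≤ n + 1 := fun n t ht => by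
    refine Nat.floor_le_of_le ?_
    simpa using mul_le_mul_of_nonneg_left ht (hNpos n).le
  have hgrid : ∀ n s t, 0 ≤ s → s ≤ t → t ≤ 1 →
      ‖e n (f n t) - e n (f n s) - (G (p n t) (e n (f n s)) - G (p n s) (e n (f n s)))‖
        ≤ C * (p n t - p n s) ^ (2 * γ) := by
    intro n s t hs hst ht
    obtain ⟨m, hm⟩ := Nat.exists_eq_add_of_le (hfmono n s t hst)
    have := hrem n m (f n s) (by rw [← hm]; exact hfN n t ht)
    rw [← hm] at this
    refine this.trans (le_of_eq ?_)
    congr 2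
    rw [← sub_div, hm]
    push_cast
    ring
  have hbdd : ∀ t, 0 ≤ t → t ≤ 1 → ∀ n, e n (f n t) ∈ Metric.closedBall x₀ (C + M) := by
    intro t h0 h1 n
    have h := hgrid n 0 t le_rfl h0 h1
    have hf0 : f n 0 = 0 := by simp [f]
    have hpz : p n 0 = 0 := by simp [p, hf0]
    rw [hf0, he0, hpz, sub_zero] at h
    have hp1 : p n t ≤ 1 := (hple n t h0).trans h1
    have h2 := hG 0 (p n t) x₀ le_rfl (hp0 n t) hp1
    rw [sub_zero] at h2
    have h3 := Real.rpow_le_one (hp0 n t) hp1 hγ0.le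
    have h4 := Real.rpow_le_one (hp0 n t) hp1 (by positivity : 0 ≤ 2 * γ)
    rw [mem_closedBall_iff_norm]
    refine (norm_le_norm_sub_add _ (G (p n t) x₀ - G 0 x₀)).trans ?_
    nlinarith
  let U : Ultrafilter ℕ := hyperfilter ℕ
  have hU : (U : Filter ℕ) ≤ atTop := by
    rw [← Nat.cofinite_eq_atTop]; exact hyperfilter_le_cofinite
  have hlim : ∀ t, ∃ x, 0 ≤ t → t ≤ 1 → Tendsto (fun n => e n (f n t)) U (𝓝 x) := by
    intro t
    by_cases h : 0 ≤ t ∧ t ≤ 1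
    · obtain ⟨x, -, hx⟩ := (isCompact_closedBall x₀ (C + M)).ultrafilter_le_nhds
        (U.map fun n => e n (f n t))
        (by
          rw [le_principal_iff]
          exact Ultrafilter.mem_map.2 (Filter.univ_mem' (hbdd t h.1 h.2)))
      exact ⟨x, fun _ _ => hx⟩
    · exact ⟨x₀, fun h0 h1 => absurd ⟨h0, h1⟩ h⟩
  choose θ hθ using hlim
  have hone : Tendsto (fun n : ℕ => 1 / ((n + 1 : ℕ) : ℝ)) U (𝓝 0) := by
    have := (tendsto_one_div_add_atTop_nhds_zero_nat (𝕜 := ℝ)).mono_left hU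
    simpa using this
  have hptend : ∀ t, 0 ≤ t → Tendsto (fun n => p n t) U (𝓝 t) := fun t ht => by
    refine tendsto_of_tendsto_of_tendsto_of_le_of_le (g := fun n : ℕ => t - 1 / ((n + 1 : ℕ) : ℝ))
      (h := fun _ => t) ?_ tendsto_const_nhds
      (fun n => by have := hlep n t ht; simp only; linarith) (fun n => hple n t ht)
    simpa using tendsto_const_nhds.sub hone
  refine ⟨θ, C, hC0, ?_, ?_⟩
  · refine tendsto_nhds_unique (hθ 0 le_rfl zero_le_one) ?_
    have : ∀ n, e n (f n 0) = x₀ := fun n => by simp [f, he0]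
    simp only [this]
    exact tendsto_const_nhds
  intro s t hs hst ht
  have ht0 := hs.trans hst
  have hs1 := hst.trans ht
  have hcont : Continuous fun x => G t x - G s x := by
    refine (LipschitzWith.of_dist_le_mul (K := ⟨M * (t - s) ^ γ, ?_⟩) fun x y => ?_).continuous
    · exact mul_nonneg hM (Real.rpow_nonneg (by linarith) _)
    · rw [dist_eq_norm, dist_eq_norm]
      exact hL s t x y hs hst ht
  have hle : ∀ n, ‖e n (f n t) - e n (f n s) - (G t (e n (f n s)) - G s (e n (f n s)))‖ ≤
      C * (p n t - p n s) ^ (2 * γ) + (M * (t - p n t) ^ γ + M * (s - p n s) ^ γ) := by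
    intro n
    have h1 := hgrid n s t hs hst ht
    have h2 := hG (p n t) t (e n (f n s)) (hp0 n t) (hple n t ht0) ht
    have h3 := hG (p n s) s (e n (f n s)) (hp0 n s) (hple n s hs) hs1
    rw [← norm_neg] at h2
    refine le_trans (le_of_eq ?_) (norm_add_le_of_le h1 (norm_add_le_of_le h2 h3))
    congr 1
    abel
  refine le_of_tendsto_of_tendsto (b := (U : Filter ℕ)) ?_ ?_ (Eventually.of_forall hle)
  · exact (((hθ t ht0 ht).sub (hθ s hs hs1)).sub ((hcont.tendsto _).comp (hθ s hs hs1))).norm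
  · have z : ∀ u, 0 ≤ u → Tendsto (fun n => M * (u - p n u) ^ γ) U (𝓝 0) := fun u hu => by
      have := ((tendsto_const_nhds (x := u)).sub (hptend u hu)).rpow_const
        (p := γ) (Or.inr hγ0.le)
      simpa [Real.zero_rpow hγ0.ne'] using this.const_mul M
    have := (((hptend t ht0).sub (hptend s hs)).rpow_const
      (p := 2 * γ) (Or.inr (by positivity))).const_mul C |>.add ((z t ht0).add (z s hs))
    simpa using this

/-- The Fourier–Laplace transform `∫_s^t f(u) exp(i ζ u) du` at a complex frequency `ζ`. -/
def fourierLaplace (f : ℝ → ℂ) (s t : ℝ) (ζ : ℂ) : ℂ :=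
  ∫ u in s..t, f u * Complex.exp (Complex.I * ζ * u)

lemma differentiable_fourierLaplace {f : ℝ → ℂ} (hf : Continuous f) (s t : ℝ) :
    Differentiable ℂ (fourierLaplace f s t) := by
  intro ζ₀
  have h := intervalIntegral.hasDerivAt_integral_of_dominated_loc_of_deriv_le
    (μ := volume) (a := s) (b := t)
    (F := fun (ζ : ℂ) (u : ℝ) => f u * Complex.exp (Complex.I * ζ * u))
    (F' := fun (ζ : ℂ) (u : ℝ) => f u * (Complex.exp (Complex.I * ζ * u) * (Complex.I * u)))
    (x₀ := ζ₀) (s := Metric.ball ζ₀ 1)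
    (bound := fun u => ‖f u‖ * (Real.exp ((‖ζ₀‖ + 1) * |u|) * |u|))
    (Metric.ball_mem_nhds _ one_pos)
    (Eventually.of_forall fun ζ => Continuous.aestronglyMeasurable (by fun_prop))
    (Continuous.intervalIntegrable (by fun_prop) _ _)
    (Continuous.aestronglyMeasurable (by fun_prop))
    (Eventually.of_forall fun u _ ζ hζ => ?_)
    (Continuous.intervalIntegrable (by fun_prop) _ _)
    (Eventually.of_forall fun u _ ζ _ => ?_)
  · exact h.2.differentiableAt
  · rw [norm_mul, norm_mul, norm_mul, Complex.norm_I, one_mul, Complex.norm_real, Real.norm_eq_abs]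
    gcongr
    rw [Complex.norm_exp, Real.exp_le_exp]
    refine (Complex.re_le_norm _).trans ?_
    rw [norm_mul, norm_mul, Complex.norm_I, one_mul, Complex.norm_real, Real.norm_eq_abs]
    gcongr
    have := norm_le_norm_add_norm_sub ζ₀ ζ
    rw [mem_ball_iff_norm'] at hζ
    linarith
  · have h1 : HasDerivAt (fun ζ : ℂ => Complex.I * ζ * u) (Complex.I * u) ζ := by
      simpa using ((hasDerivAt_id ζ).const_mul Complex.I).mul_const (u : ℂ)
    exact (h1.cexp).const_mul (f u)

lemma norm_fourierLaplace_le {f : ℝ → ℂ} (hf : ∀ u, ‖f u‖ = 1) {s t : ℝ} (hst : s ≤ t) {ζ : ℂ}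
    {B : ℝ} (hB : ∀ u, s ≤ u → u ≤ t → -(ζ.im * u) ≤ B) :
    ‖fourierLaplace f s t ζ‖ ≤ Real.exp B * (t - s) := by
  rw [← abs_of_nonneg (sub_nonneg.2 hst)]
  refine intervalIntegral.norm_integral_le_of_norm_le_const fun u hu => ?_
  rw [Set.uIoc_of_le hst] at hu
  rw [norm_mul, hf, one_mul, Complex.norm_exp, Real.exp_le_exp]
  simpa using hB u hu.1.le hu.2

lemma conj_fourierLaplace (f : ℝ → ℂ) (s t : ℝ) (ω : ℝ) :
    starRingEnd ℂ (fourierLaplace f s t ω) =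
      fourierLaplace (fun u => starRingEnd ℂ (f u)) s t (-ω) := by
  unfold fourierLaplace
  rw [← intervalIntegral.intervalIntegral_conj]
  simp only [map_mul, ← Complex.exp_conj, Complex.conj_I, Complex.conj_ofReal]
  congr! 4
  ring_nf

open scoped FourierTransform in
lemma fourier_indicator_Ioc_eq (f : ℝ → ℂ) {s t : ℝ} (hst : s ≤ t) (x : ℝ) :
    𝓕 ((Set.Ioc s t).indicator f) x = fourierLaplace f s t ((-2 * Real.pi * x : ℝ) : ℂ) := by
  rw [Real.fourier_real_eq_integral_exp_smul, fourierLaplace,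
    intervalIntegral.integral_of_le hst, ← integral_indicator measurableSet_Ioc]
  congr 1
  ext u
  by_cases hu : u ∈ Set.Ioc s t
  · simp only [Set.indicator_of_mem hu, smul_eq_mul]
    rw [mul_comm]
    congr 2
    push_cast
    ring
  · simp [Set.indicator_of_notMem hu]

open scoped FourierTransform in
lemma exists_fourierLaplace_ne_zero {f : ℝ → ℂ} (hf : Continuous f) (hf1 : ∀ u, ‖f u‖ = 1)
    {s t : ℝ} (hst : s < t) : ∃ ω : ℝ, fourierLaplace f s t ω ≠ 0 := by
  by_contra! h
  have hF : 𝓕 ((Set.Ioc s t).indicator f) = 0 := by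
    ext x
    rw [fourier_indicator_Ioc_eq f hst.le, h]
    rfl
  have hint : Integrable ((Set.Ioc s t).indicator f) :=
    (integrable_indicator_iff measurableSet_Ioc).2
      ((hf.integrableOn_Icc (a := s) (b := t)).mono_set Set.Ioc_subset_Icc_self)
  have hmem : (s + t) / 2 ∈ Set.Ioo s t := ⟨by linarith, by linarith⟩
  have hca : ContinuousAt ((Set.Ioc s t).indicator f) ((s + t) / 2) := by
    refine hf.continuousAt.congr ?_
    filter_upwards [Ioo_mem_nhds hmem.1 hmem.2] with u hu
    rw [Set.indicator_of_mem (Set.Ioo_subset_Ioc_self hu)]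
  have hinv := hint.fourierInv_fourier_eq (by rw [hF]; exact integrable_zero _ _ _) hca
  rw [hF, Set.indicator_of_mem (Set.Ioo_subset_Ioc_self hmem), Real.fourierInv_eq] at hinv
  simp only [Pi.zero_apply, smul_zero, integral_zero] at hinv
  have := hf1 ((s + t) / 2)
  rw [← hinv] at this
  simp at this

lemma tendsto_fourierLaplace_atTop (f : ℝ → ℂ) {s t : ℝ} (hst : s ≤ t) :
    Tendsto (fun x : ℝ => fourierLaplace f s t ((-2 * Real.pi * x : ℝ) : ℂ)) atTop (𝓝 0) := by
  simp only [← fourier_indicator_Ioc_eq f hst]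
  exact (Real.zero_at_infty_fourier _).mono_left atTop_le_cocompact

/-- The phases of the transforms of a unimodular function over two non-overlapping intervals
are not aligned at almost every real frequency. -/
lemma ae_fourierLaplace_not_aligned {f : ℝ → ℂ} (hf : Continuous f) (hf1 : ∀ u, ‖f u‖ = 1)
    {s t s' t' : ℝ} (hst : s < t) (hts : t ≤ s') (hst' : s' < t') {c c' : ℂ} (hc : c ≠ 0)
    (hc' : c' ≠ 0) :
    ∀ᵐ ω : ℝ, (fourierLaplace f s t ω * c) * starRingEnd ℂ (fourierLaplace f s' t' ω * c') -
      (fourierLaplace f s' t' ω * c') * starRingEnd ℂ (fourierLaplace f s t ω * c) ≠ 0 := by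
  set g : ℝ → ℂ := fun u => starRingEnd ℂ (f u) with hg
  have hgc : Continuous g := Complex.continuous_conj.comp hf
  have hg1 : ∀ u, ‖g u‖ = 1 := fun u => by rw [hg, RCLike.norm_conj, hf1]
  let H : ℂ → ℂ := fun ζ => fourierLaplace f s t ζ * fourierLaplace g s' t' (-ζ)
  let H' : ℂ → ℂ := fun ζ => fourierLaplace f s' t' ζ * fourierLaplace g s t (-ζ)
  let D : ℂ → ℂ := fun ζ => c * starRingEnd ℂ c' * H ζ - c' * starRingEnd ℂ c * H' ζ
  have d1 := differentiable_fourierLaplace hf s t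
  have d2 := differentiable_fourierLaplace hf s' t'
  have d3 := (differentiable_fourierLaplace hgc s t).comp differentiable_neg
  have d4 := (differentiable_fourierLaplace hgc s' t').comp differentiable_neg
  have hHd : Differentiable ℂ H := d1.mul d4
  have hH'd : Differentiable ℂ H' := d2.mul d3
  have hDd : Differentiable ℂ D := (hHd.const_mul _).sub (hH'd.const_mul _)
  have hDeq : ∀ ω : ℝ, (fourierLaplace f s t ω * c) *
      starRingEnd ℂ (fourierLaplace f s' t' ω * c') -
      (fourierLaplace f s' t' ω * c') * starRingEnd ℂ (fourierLaplace f s t ω * c) = D ω := by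
    intro ω
    simp only [map_mul, conj_fourierLaplace]
    ring
  simp only [hDeq]
  have hDan : AnalyticOnNhd ℂ D Set.univ := fun z _ => hDd.analyticAt z
  have hDr : AnalyticOnNhd ℝ (fun ω : ℝ => D ω) Set.univ := fun ω _ =>
    AnalyticAt.comp (g := D) (f := fun ω : ℝ => (ω : ℂ)) ((hDd.analyticAt _).restrictScalars)
      (Complex.ofRealCLM.analyticAt ω)
  rcases hDr.eqOn_zero_or_eventually_ne_zero_of_preconnected isPreconnected_univ with h0 | h
  swap
  · have := ae_restrict_le_codiscreteWithin (μ := (volume : Measure ℝ)) MeasurableSet.univ h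
    rwa [Measure.restrict_univ] at this
  exfalso
  have hfreq : ∃ᶠ z in 𝓝[≠] (0 : ℂ), D z = 0 := by
    have h1 : Tendsto (fun ω : ℝ => (ω : ℂ)) (𝓝[≠] 0) (𝓝[≠] (0 : ℂ)) := by
      refine tendsto_nhdsWithin_iff.2 ⟨?_, ?_⟩
      · exact (Complex.continuous_ofReal.tendsto' 0 0 (by simp)).mono_left nhdsWithin_le_nhds
      · filter_upwards [self_mem_nhdsWithin] with ω hω
        simpa using hω
    exact h1.frequently (Eventually.of_forall fun ω => h0 (Set.mem_univ ω)).frequently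
  have hD0 : ∀ z, D z = 0 := fun z =>
    hDan.eqOn_zero_of_preconnected_of_frequently_eq_zero isPreconnected_univ
      (Set.mem_univ 0) hfreq (Set.mem_univ z)
  set k := c * starRingEnd ℂ c' with hk
  set k' := c' * starRingEnd ℂ c with hk'
  have hk0 : k ≠ 0 := mul_ne_zero hc ((map_ne_zero _).2 hc')
  have hkk : ‖k'‖ = ‖k‖ := by simp [hk, hk', mul_comm]
  have hHH : ∀ z, ‖H z‖ = ‖H' z‖ := fun z => by
    have : ‖k * H z‖ = ‖k' * H' z‖ := congrArg norm (sub_eq_zero.1 (hD0 z))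
    rw [norm_mul k, norm_mul k', hkk] at this
    exact mul_left_cancel₀ (norm_ne_zero_iff.2 hk0) this
  have hbound : ∀ z, ‖H z‖ ≤ (t - s) * (t' - s') := by
    intro z
    have key : ∀ (f g : ℝ → ℂ), (∀ u, ‖f u‖ = 1) → (∀ u, ‖g u‖ = 1) → ∀ z : ℂ, z.im ≤ 0 →
        ‖fourierLaplace f s t z‖ * ‖fourierLaplace g s' t' (-z)‖ ≤ (t - s) * (t' - s') := by
      intro f g hf1 hg1 z hz
      have e1 := norm_fourierLaplace_le hf1 hst.le (ζ := z) (B := -(z.im * t))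
        (fun u _ hu => neg_le_neg (mul_le_mul_of_nonpos_left hu hz))
      have e2 := norm_fourierLaplace_le hg1 hst'.le (ζ := -z) (B := z.im * s')
        (fun u hu _ => by
          rw [Complex.neg_im, neg_mul, neg_neg]
          exact mul_le_mul_of_nonpos_left hu hz)
      have e3 : Real.exp (-(z.im * t)) * Real.exp (z.im * s') ≤ 1 := by
        rw [← Real.exp_add, Real.exp_le_one_iff]
        have := mul_le_mul_of_nonpos_left hts hz
        linarith
      have p1 : 0 < t - s := sub_pos.2 hst
      have p2 : 0 < t' - s' := sub_pos.2 hst'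
      calc _ ≤ (Real.exp (-(z.im * t)) * (t - s)) * (Real.exp (z.im * s') * (t' - s')) := by gcongr
        _ = (Real.exp (-(z.im * t)) * Real.exp (z.im * s')) * ((t - s) * (t' - s')) := by ring
        _ ≤ 1 * ((t - s) * (t' - s')) := by gcongr
        _ = _ := one_mul _
    rcases le_total z.im 0 with hz | hz
    · rw [norm_mul]
      exact key f g hf1 hg1 z hz
    · rw [hHH, norm_mul, mul_comm]
      have := key g f hg1 hf1 (-z) (by simpa using hz)
      rwa [neg_neg] at this
  have hconst : ∀ z, H z = H 0 := fun z => hHd.apply_eq_apply_of_bounded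
    (isBounded_iff_forall_norm_le.2 ⟨_, by rintro _ ⟨z, rfl⟩; exact hbound z⟩) z 0
  have hH0 : H 0 = 0 := by
    have hz : Tendsto (fun x : ℝ => H ((-2 * Real.pi * x : ℝ) : ℂ)) atTop (𝓝 0) := by
      refine (tendsto_fourierLaplace_atTop f hst.le).zero_mul_isBoundedUnder_le ?_
      refine isBoundedUnder_of ⟨t' - s', fun x => ?_⟩
      have := norm_fourierLaplace_le hg1 hst'.le (ζ := -((-2 * Real.pi * x : ℝ) : ℂ)) (B := 0)
        (fun u _ _ => by simp [-Complex.ofReal_mul])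
      simpa using this
    simp only [hconst] at hz
    exact tendsto_nhds_unique tendsto_const_nhds hz
  rcases AnalyticOnNhd.eq_zero_or_eq_zero_of_mul_eq_zero (U := Set.univ)
    (fun z _ => d1.analyticAt z) (fun z _ => d4.analyticAt z)
    (fun z _ => (hconst z).trans hH0) isPreconnected_univ with h | h
  · obtain ⟨ω, hω⟩ := exists_fourierLaplace_ne_zero hf hf1 hst
    exact hω (h _ (Set.mem_univ _))
  · obtain ⟨ω, hω⟩ := exists_fourierLaplace_ne_zero hgc hg1 hst'
    refine hω ?_
    simpa using h (-ω) (Set.mem_univ _)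

lemma IntervalPartition.pts_le_pts {s t : ℝ} (P : IntervalPartition s t) {i j : ℕ} (hij : i ≤ j)
    (hj : j ≤ P.n) : P.pts i ≤ P.pts j := by
  induction j, hij using Nat.le_induction with
  | base => exact le_rfl
  | succ k _ ih => exact (ih (by omega)).trans (P.mono k (by omega))

lemma IntervalPartition.le_pts {s t : ℝ} (P : IntervalPartition s t) {i : ℕ} (hi : i ≤ P.n) :
    s ≤ P.pts i :=
  P.first.symm.trans_le (P.pts_le_pts (Nat.zero_le i) hi)

lemma IntervalPartition.pts_le {s t : ℝ} (P : IntervalPartition s t) {i : ℕ} (hi : i ≤ P.n) :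
    P.pts i ≤ t :=
  (P.pts_le_pts hi le_rfl).trans_eq P.last

lemma exists_pos_mul_rpow_lt (C : ℝ) {p ε : ℝ} (hp : 0 < p) (hε : 0 < ε) :
    ∃ δ > 0, C * δ ^ p < ε := by
  have h : Tendsto (fun δ : ℝ => C * δ ^ p) (𝓝[>] 0) (𝓝 0) := by
    have := ((Real.continuousAt_rpow_const 0 p (Or.inr hp.le)).tendsto.mono_left
      (nhdsWithin_le_nhds (s := Set.Ioi 0))).const_mul C
    simpa [Real.zero_rpow hp.ne'] using this
  obtain ⟨δ, h1, h2⟩ := ((h.eventually_lt_const hε).and self_mem_nhdsWithin).exists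
  exact ⟨δ, h2, h1⟩

/-- A path whose increments are approximated by the averaged field up to order `2 * γ > 1` is the
nonlinear Young integral along itself. -/
lemma hasSigmaIntegral_of_remainder_le {d : ℕ} {w : ℝ → Euc d} {bhat : ℝ × Euc d → Fin d → ℂ}
    {θ : ℝ → Euc d} {C γ : ℝ} (hγ : 1 / 2 < γ) (hC : 0 ≤ C)
    (h : ∀ s t, 0 ≤ s → s ≤ t → t ≤ 1 →
      ‖θ t - θ s - sigmaAvg w bhat s t (θ s)‖ ≤ C * (t - s) ^ (2 * γ))
    {t : ℝ} (ht1 : t ≤ 1) : HasSigmaIntegral w bhat θ 0 t (θ t - θ 0) := by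
  intro ε hε
  obtain ⟨δ, hδ, hlt⟩ := exists_pos_mul_rpow_lt C (p := 2 * γ - 1) (by linarith) hε
  refine ⟨δ, hδ, fun P hP => lt_of_le_of_lt ?_ hlt⟩
  have htel : θ t - θ 0 = ∑ i ∈ Finset.range P.n, (θ (P.pts (i + 1)) - θ (P.pts i)) := by
    rw [Finset.sum_range_sub (fun i => θ (P.pts i)), P.first, P.last]
  have hlen : ∑ i ∈ Finset.range P.n, (P.pts (i + 1) - P.pts i) = t := by
    rw [Finset.sum_range_sub P.pts, P.first, P.last, sub_zero]
  rw [norm_sub_rev, htel, sigmaRiemannSum, ← Finset.sum_sub_distrib]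
  calc _ ≤ ∑ i ∈ Finset.range P.n, C * δ ^ (2 * γ - 1) * (P.pts (i + 1) - P.pts i) := by
        refine norm_sum_le_of_le _ fun i hi => ?_
        have hi' := Finset.mem_range.1 hi
        have hd0 : 0 ≤ P.pts (i + 1) - P.pts i := sub_nonneg.2 (P.mono i hi')
        refine (h _ _ (P.le_pts hi'.le) (P.mono i hi') ((P.pts_le hi').trans ht1)).trans ?_
        rw [mul_assoc]
        refine mul_le_mul_of_nonneg_left ?_ hC
        have e : (2 * γ : ℝ) = (2 * γ - 1) + 1 := by ring
        rw [e, Real.rpow_add_one' hd0 (by linarith), ← e]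
        refine mul_le_mul_of_nonneg_right ?_ hd0
        exact Real.rpow_le_rpow hd0 (hP i hi').le (by linarith)
    _ = C * δ ^ (2 * γ - 1) * t := by rw [← Finset.mul_sum, hlen]
    _ ≤ C * δ ^ (2 * γ - 1) * 1 := by gcongr
    _ = _ := mul_one _

lemma Yint_eq_fourierLaplace {d : ℕ} (w : ℝ → Euc d) (s t ω : ℝ) (ξ : Euc d) :
    Yint w s t ω ξ =
      fourierLaplace (fun u => Complex.exp (Complex.I * (inner ℝ ξ (w u) : ℝ))) s t ω := by
  unfold Yint fourierLaplace
  congr 1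
  ext u
  rw [← Complex.exp_add]
  congr 1
  push_cast
  ring

lemma continuous_Yint {d : ℕ} {w : ℝ → Euc d} (hw : Continuous w) (s t : ℝ) :
    Continuous fun p : ℝ × Euc d => Yint w s t p.1 p.2 := by
  unfold Yint
  refine intervalIntegral.continuous_parametric_intervalIntegral_of_continuous' ?_ _ _
  simp only [Function.uncurry_def]
  fun_prop

lemma Yint_sub {d : ℕ} {w : ℝ → Euc d} (hw : Continuous w) (r s t ω : ℝ) (ξ : Euc d) :
    Yint w r t ω ξ - Yint w r s ω ξ = Yint w s t ω ξ :=
  intervalIntegral.integral_interval_sub_left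
    (Continuous.intervalIntegrable (by fun_prop) _ _)
    (Continuous.intervalIntegrable (by fun_prop) _ _)

lemma norm_Yint_le {d : ℕ} {w : ℝ → Euc d} {α γ : ℝ} (hK : avgK w α γ < ⊤) {s t : ℝ} (hs : 0 ≤ s)
    (hst : s ≤ t) (ht : t ≤ 1) (ω : ℝ) (ξ : Euc d) :
    ‖Yint w s t ω ξ‖ ≤ (avgK w α γ).toReal *
      ((1 + ‖ξ‖) ^ α * (1 + Real.sqrt (Real.log (1 + |ω|))) * (t - s) ^ γ) := by
  have h1 : (0 : ℝ) < 1 + ‖ξ‖ := by positivity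
  rcases hst.eq_or_lt with rfl | hst
  · simp only [Yint, intervalIntegral.integral_same, norm_zero, sub_self]
    positivity
  have h2 : 0 < (t - s) ^ γ := Real.rpow_pos_of_pos (sub_pos.2 hst) _
  rw [← div_le_iff₀ (by positivity)]
  refine (ENNReal.ofReal_le_iff_le_toReal hK.ne).1 ?_
  unfold avgK
  exact le_iSup₂_of_le s t <| le_iSup₂_of_le hs hst <| le_iSup_of_le ht <| le_iSup₂_of_le ω ξ le_rfl

/-- The integrand of `FLnorm`. -/
def FLweight (d : ℕ) (α : ℝ) (bhat : ℝ × Euc d → Fin d → ℂ) (p : ℝ × Euc d) : ℝ :=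
  ‖bhat p‖ * (1 + ‖p.2‖) ^ α * (1 + Real.sqrt (Real.log (1 + |p.1|)))

lemma lintegral_ofReal_le_of_le_FLweight {d : ℕ} {α c : ℝ} {bhat : ℝ × Euc d → Fin d → ℂ}
    {F : ℝ × Euc d → ℝ} (hc : 0 ≤ c) (hF : ∀ p, ‖F p‖ ≤ c * FLweight d α bhat p) :
    ∫⁻ p, ENNReal.ofReal ‖F p‖ ≤ ENNReal.ofReal c * FLnorm d α bhat := by
  unfold FLnorm
  rw [← lintegral_const_mul' _ _ ENNReal.ofReal_ne_top]
  refine lintegral_mono fun p => ?_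
  rw [← ENNReal.ofReal_mul hc]
  exact ENNReal.ofReal_le_ofReal (hF p)

lemma abs_integral_le_of_le_FLweight {d : ℕ} {α c : ℝ} {bhat : ℝ × Euc d → Fin d → ℂ}
    (hb : FLnorm d α bhat < ⊤) {F : ℝ × Euc d → ℝ} (hc : 0 ≤ c)
    (hF : ∀ p, ‖F p‖ ≤ c * FLweight d α bhat p) :
    ‖∫ p, F p‖ ≤ c * (FLnorm d α bhat).toReal := by
  refine (norm_integral_le_lintegral_norm F).trans ?_
  have h := ENNReal.toReal_mono (ENNReal.mul_ne_top ENNReal.ofReal_ne_top hb.ne)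
    (lintegral_ofReal_le_of_le_FLweight hc hF)
  rwa [ENNReal.toReal_mul, ENNReal.toReal_ofReal hc] at h

lemma integrable_of_le_FLweight {d : ℕ} {α c : ℝ} {bhat : ℝ × Euc d → Fin d → ℂ}
    (hb : FLnorm d α bhat < ⊤) {F : ℝ × Euc d → ℝ} (hFm : AEStronglyMeasurable F) (hc : 0 ≤ c)
    (hF : ∀ p, ‖F p‖ ≤ c * FLweight d α bhat p) : Integrable F := by
  refine ⟨hFm, ?_⟩
  rw [hasFiniteIntegral_iff_norm]
  exact (lintegral_ofReal_le_of_le_FLweight hc hF).trans_lt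
    (ENNReal.mul_lt_top ENNReal.ofReal_lt_top hb)

/-- The integrand of the `i`-th coordinate of `sigmaAvg`. -/
def sigmaIntegrand {d : ℕ} (w : ℝ → Euc d) (bhat : ℝ × Euc d → Fin d → ℂ) (i : Fin d) (s t : ℝ)
    (x : Euc d) (p : ℝ × Euc d) : ℝ :=
  (bhat p i * Yint w s t p.1 p.2 * Complex.exp (Complex.I * Complex.ofReal (inner ℝ p.2 x))).re

lemma sigmaAvg_apply {d : ℕ} (w : ℝ → Euc d) (bhat : ℝ × Euc d → Fin d → ℂ) (s t : ℝ)
    (x : Euc d) (i : Fin d) :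
    sigmaAvg w bhat s t x i = ∫ p, sigmaIntegrand w bhat i s t x p := rfl

lemma norm_mul_Yint_le {d : ℕ} {w : ℝ → Euc d} {α γ : ℝ} (hK : avgK w α γ < ⊤)
    (bhat : ℝ × Euc d → Fin d → ℂ) {s t : ℝ} (hs : 0 ≤ s)
    (hst : s ≤ t) (ht : t ≤ 1) (i : Fin d) (p : ℝ × Euc d) :
    ‖bhat p i * Yint w s t p.1 p.2‖ * (1 + ‖p.2‖) ≤
      (avgK w α γ).toReal * (t - s) ^ γ * FLweight d (α + 1) bhat p := by
  have h1 : (0 : ℝ) < 1 + ‖p.2‖ := by positivity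
  rw [norm_mul, FLweight, Real.rpow_add_one h1.ne']
  calc _ ≤ ‖bhat p‖ * ((avgK w α γ).toReal * ((1 + ‖p.2‖) ^ α *
        (1 + Real.sqrt (Real.log (1 + |p.1|))) * (t - s) ^ γ)) * (1 + ‖p.2‖) := by
        gcongr
        · exact norm_le_pi_norm _ i
        · exact norm_Yint_le hK hs hst ht _ _
    _ = _ := by ring

lemma norm_sigmaIntegrand_le {d : ℕ} {w : ℝ → Euc d} {α γ : ℝ} (hK : avgK w α γ < ⊤)
    (bhat : ℝ × Euc d → Fin d → ℂ) {s t : ℝ} (hs : 0 ≤ s)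
    (hst : s ≤ t) (ht : t ≤ 1) (i : Fin d) (x : Euc d) (p : ℝ × Euc d) :
    ‖sigmaIntegrand w bhat i s t x p‖ ≤
      (avgK w α γ).toReal * (t - s) ^ γ * FLweight d (α + 1) bhat p := by
  refine le_trans ?_ (norm_mul_Yint_le hK bhat hs hst ht i p)
  refine (Complex.abs_re_le_norm _).trans ?_
  rw [norm_mul, mul_comm Complex.I, Complex.norm_exp_ofReal_mul_I]
  gcongr
  linarith [norm_nonneg p.2]

lemma norm_sigmaIntegrand_sub_le {d : ℕ} {w : ℝ → Euc d} {α γ : ℝ} (hK : avgK w α γ < ⊤)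
    (bhat : ℝ × Euc d → Fin d → ℂ) {s t : ℝ} (hs : 0 ≤ s)
    (hst : s ≤ t) (ht : t ≤ 1) (i : Fin d) (x y : Euc d) (p : ℝ × Euc d) :
    ‖sigmaIntegrand w bhat i s t x p - sigmaIntegrand w bhat i s t y p‖ ≤
      (avgK w α γ).toReal * (t - s) ^ γ * ‖x - y‖ * FLweight d (α + 1) bhat p := by
  have hexp : ‖Complex.exp (Complex.I * Complex.ofReal (inner ℝ p.2 x)) -
      Complex.exp (Complex.I * Complex.ofReal (inner ℝ p.2 y))‖ ≤ (1 + ‖p.2‖) * ‖x - y‖ := by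
    have e : Complex.exp (Complex.I * Complex.ofReal (inner ℝ p.2 x)) -
        Complex.exp (Complex.I * Complex.ofReal (inner ℝ p.2 y)) =
        Complex.exp (Complex.ofReal (inner ℝ p.2 y) * Complex.I) *
          (Complex.exp (Complex.I * Complex.ofReal (inner ℝ p.2 (x - y))) - 1) := by
      rw [mul_sub, ← Complex.exp_add, inner_sub_right]
      push_cast
      ring_nf
    rw [e, norm_mul, Complex.norm_exp_ofReal_mul_I, one_mul]
    refine Real.norm_exp_I_mul_ofReal_sub_one_le.trans ((norm_inner_le_norm _ _).trans ?_)
    gcongr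
    linarith
  unfold sigmaIntegrand
  rw [← Complex.sub_re, ← mul_sub]
  refine (Complex.abs_re_le_norm _).trans ?_
  rw [norm_mul]
  calc _ ≤ ‖bhat p i * Yint w s t p.1 p.2‖ * ((1 + ‖p.2‖) * ‖x - y‖) := by gcongr
    _ = ‖bhat p i * Yint w s t p.1 p.2‖ * (1 + ‖p.2‖) * ‖x - y‖ := by ring
    _ ≤ (avgK w α γ).toReal * (t - s) ^ γ * FLweight d (α + 1) bhat p * ‖x - y‖ :=
        mul_le_mul_of_nonneg_right (norm_mul_Yint_le hK bhat hs hst ht i p) (norm_nonneg _)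
    _ = _ := by ring

lemma integrable_sigmaIntegrand {d : ℕ} {w : ℝ → Euc d} (hw : Continuous w) {α γ : ℝ}
    (hK : avgK w α γ < ⊤) {bhat : ℝ × Euc d → Fin d → ℂ} (hb : FLnorm d (α + 1) bhat < ⊤)
    {i : Fin d} (hm : AEStronglyMeasurable fun p => bhat p i) {s t : ℝ} (hs : 0 ≤ s)
    (hst : s ≤ t) (ht : t ≤ 1) (x : Euc d) : Integrable (sigmaIntegrand w bhat i s t x) := by
  refine integrable_of_le_FLweight hb ?_
    (mul_nonneg ENNReal.toReal_nonneg (Real.rpow_nonneg (sub_nonneg.2 hst) _))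
    (norm_sigmaIntegrand_le hK bhat hs hst ht i x)
  have hY := (continuous_Yint hw s t).aestronglyMeasurable (μ := volume)
  have hE : Continuous fun p : ℝ × Euc d =>
      Complex.exp (Complex.I * Complex.ofReal (inner ℝ p.2 x)) := by fun_prop
  exact Complex.continuous_re.comp_aestronglyMeasurable
    ((hm.mul hY).mul hE.aestronglyMeasurable)

lemma abs_sigmaAvg_apply_le {d : ℕ} {w : ℝ → Euc d} {α γ : ℝ} (hK : avgK w α γ < ⊤)
    {bhat : ℝ × Euc d → Fin d → ℂ} (hb : FLnorm d (α + 1) bhat < ⊤) {s t : ℝ} (hs : 0 ≤ s)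
    (hst : s ≤ t) (ht : t ≤ 1) (x : Euc d) (i : Fin d) :
    ‖sigmaAvg w bhat s t x i‖ ≤
      (avgK w α γ).toReal * (t - s) ^ γ * (FLnorm d (α + 1) bhat).toReal :=
  abs_integral_le_of_le_FLweight hb
    (mul_nonneg ENNReal.toReal_nonneg (Real.rpow_nonneg (sub_nonneg.2 hst) _))
    (norm_sigmaIntegrand_le hK bhat hs hst ht i x)

lemma abs_sigmaAvg_apply_sub_le {d : ℕ} {w : ℝ → Euc d} (hw : Continuous w) {α γ : ℝ}
    (hK : avgK w α γ < ⊤) {bhat : ℝ × Euc d → Fin d → ℂ} (hb : FLnorm d (α + 1) bhat < ⊤)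
    {i : Fin d} (hm : AEStronglyMeasurable fun p => bhat p i) {s t : ℝ} (hs : 0 ≤ s)
    (hst : s ≤ t) (ht : t ≤ 1) (x y : Euc d) :
    ‖sigmaAvg w bhat s t x i - sigmaAvg w bhat s t y i‖ ≤
      (avgK w α γ).toReal * (t - s) ^ γ * ‖x - y‖ * (FLnorm d (α + 1) bhat).toReal := by
  rw [sigmaAvg_apply, sigmaAvg_apply, ← integral_sub
    (integrable_sigmaIntegrand hw hK hb hm hs hst ht x)
    (integrable_sigmaIntegrand hw hK hb hm hs hst ht y)]
  refine abs_integral_le_of_le_FLweight hb ?_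
    (norm_sigmaIntegrand_sub_le hK bhat hs hst ht i x y)
  have := Real.rpow_nonneg (sub_nonneg.2 hst) γ
  positivity

lemma sigmaAvg_sub {d : ℕ} {w : ℝ → Euc d} (hw : Continuous w) {α γ : ℝ}
    (hK : avgK w α γ < ⊤) {bhat : ℝ × Euc d → Fin d → ℂ} (hb : FLnorm d (α + 1) bhat < ⊤)
    (hm : ∀ i, AEStronglyMeasurable fun p => bhat p i) {s t : ℝ} (hs : 0 ≤ s)
    (hst : s ≤ t) (ht : t ≤ 1) (x : Euc d) :
    sigmaAvg w bhat 0 t x - sigmaAvg w bhat 0 s x = sigmaAvg w bhat s t x := by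
  ext i
  rw [PiLp.sub_apply, sigmaAvg_apply, sigmaAvg_apply, sigmaAvg_apply, ← integral_sub
    (integrable_sigmaIntegrand hw hK hb (hm i) le_rfl (hs.trans hst) ht x)
    (integrable_sigmaIntegrand hw hK hb (hm i) le_rfl hs (hst.trans ht) x)]
  congr 1
  ext p
  unfold sigmaIntegrand
  rw [← Yint_sub hw 0 s t, ← Complex.sub_re]
  congr 1
  ring

lemma norm_le_of_forall_apply_le {d : ℕ} {v : Euc d} {c : ℝ} (h : ∀ i, ‖v i‖ ≤ c) :
    ‖v‖ ≤ d * c := by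
  rw [← (EuclideanSpace.basisFun (Fin d) ℝ).sum_repr v]
  refine (norm_sum_le_of_le _ fun i _ => ?_ : _ ≤ ∑ _i : Fin d, c).trans_eq (by simp)
  rw [norm_smul, (EuclideanSpace.basisFun (Fin d) ℝ).orthonormal.1 i, mul_one]
  exact h i

/-- Existence of a path solving the Young equation up to a remainder, for a measurable `bhat`. -/
lemma exists_path_sigmaAvg_remainder_le {d : ℕ} {α γ : ℝ} (hγ : 1 / 2 < γ)
    {w : ℝ → Euc d} (hw : Continuous w) (hK : avgK w α γ < ⊤)
    {bhat : ℝ × Euc d → Fin d → ℂ} (hb : FLnorm d (α + 1) bhat < ⊤)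
    (hm : ∀ i, AEStronglyMeasurable fun p => bhat p i) (x₀ : Euc d) :
    ∃ (θ : ℝ → Euc d) (C : ℝ), 0 ≤ C ∧ θ 0 = x₀ ∧ ∀ s t, 0 ≤ s → s ≤ t → t ≤ 1 →
      ‖θ t - θ s - sigmaAvg w bhat s t (θ s)‖ ≤ C * (t - s) ^ (2 * γ) := by
  set M : ℝ := d * ((avgK w α γ).toReal * (FLnorm d (α + 1) bhat).toReal) with hM
  obtain ⟨θ, C, hC, h0, h⟩ := exists_path_remainder_le (G := fun t x => sigmaAvg w bhat 0 t x)
    (M := M) hγ (by positivity)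
    (fun s t x hs hst ht => by
      rw [sigmaAvg_sub hw hK hb hm hs hst ht]
      refine (norm_le_of_forall_apply_le (abs_sigmaAvg_apply_le hK hb hs hst ht x)).trans_eq ?_
      rw [hM]; ring)
    (fun s t x y hs hst ht => by
      rw [sigmaAvg_sub hw hK hb hm hs hst ht, sigmaAvg_sub hw hK hb hm hs hst ht]
      refine (norm_le_of_forall_apply_le fun i =>
        abs_sigmaAvg_apply_sub_le hw hK hb (hm i) hs hst ht x y).trans_eq ?_
      rw [hM]; ring) x₀
  refine ⟨θ, C, hC, h0, fun s t hs hst ht => ?_⟩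
  have := h s t hs hst ht
  rwa [sigmaAvg_sub hw hK hb hm hs hst ht] at this

lemma holderOnIcc_of_remainder_le {d : ℕ} {α γ : ℝ} (hγ : 0 ≤ γ) {w : ℝ → Euc d}
    (hK : avgK w α γ < ⊤) {bhat : ℝ × Euc d → Fin d → ℂ} (hb : FLnorm d (α + 1) bhat < ⊤)
    {θ : ℝ → Euc d} {C : ℝ} (hC : 0 ≤ C)
    (h : ∀ s t, 0 ≤ s → s ≤ t → t ≤ 1 →
      ‖θ t - θ s - sigmaAvg w bhat s t (θ s)‖ ≤ C * (t - s) ^ (2 * γ)) : HolderOnIcc γ θ := by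
  set M : ℝ := d * ((avgK w α γ).toReal * (FLnorm d (α + 1) bhat).toReal) with hM
  have key : ∀ s t, 0 ≤ s → s ≤ t → t ≤ 1 → ‖θ t - θ s‖ ≤ (C + M) * |t - s| ^ γ := by
    intro s t hs hst ht
    have h0 : 0 ≤ t - s := sub_nonneg.2 hst
    have h1 := norm_le_of_forall_apply_le (abs_sigmaAvg_apply_le hK hb hs hst ht (θ s))
    have h2 : (t - s) ^ (2 * γ) ≤ (t - s) ^ γ :=
      Real.rpow_le_rpow_of_exponent_ge_of_imp h0 (by linarith) (by linarith)
        (fun _ h => by linarith)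
    rw [abs_of_nonneg h0]
    calc _ ≤ _ := norm_le_norm_sub_add _ (sigmaAvg w bhat s t (θ s))
      _ ≤ C * (t - s) ^ γ + M * (t - s) ^ γ := by
          refine add_le_add ((h s t hs hst ht).trans (by gcongr)) (h1.trans_eq ?_)
          rw [hM]; ring
      _ = _ := by ring
  refine ⟨C + M, fun s hs t ht => ?_⟩
  rcases le_total s t with hst | hst
  · exact key s t hs.1 hst ht.2
  · rw [norm_sub_rev, abs_sub_comm]
    exact key t s ht.1 hst hs.2

/-- Over two non-overlapping time intervals the phases of the integrands of the averaged fields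
are not aligned at almost every frequency. -/
lemma ae_Yint_not_aligned {d : ℕ} {w : ℝ → Euc d} (hw : Continuous w) {s t s' t' : ℝ}
    (hst : s < t) (hts : t ≤ s') (hst' : s' < t') {e e' : ℝ × Euc d → ℂ}
    (he : Continuous e) (he' : Continuous e') (he0 : ∀ p, e p ≠ 0) (he0' : ∀ p, e' p ≠ 0)
    (hew : ∀ ω ξ, e (ω, ξ) = e (0, ξ)) (hew' : ∀ ω ξ, e' (ω, ξ) = e' (0, ξ)) :
    ∀ᵐ p : ℝ × Euc d,
      (Yint w s t p.1 p.2 * e p) * starRingEnd ℂ (Yint w s' t' p.1 p.2 * e' p) -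
        (Yint w s' t' p.1 p.2 * e' p) * starRingEnd ℂ (Yint w s t p.1 p.2 * e p) ≠ 0 := by
  have h1 := (continuous_Yint hw s t).mul he
  have h2 := (continuous_Yint hw s' t').mul he'
  have hcont := (h1.mul (Complex.continuous_conj.comp h2)).sub
    (h2.mul (Complex.continuous_conj.comp h1))
  rw [ae_iff]
  simp only [not_not]
  have hmeas : MeasurableSet {p : ℝ × Euc d |
      (Yint w s t p.1 p.2 * e p) * starRingEnd ℂ (Yint w s' t' p.1 p.2 * e' p) -
        (Yint w s' t' p.1 p.2 * e' p) * starRingEnd ℂ (Yint w s t p.1 p.2 * e p) = 0} :=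
    (isClosed_eq hcont continuous_const).measurableSet
  rw [Measure.volume_eq_prod, Measure.prod_apply_symm hmeas, lintegral_eq_zero_iff'
    (measurable_measure_prodMk_right hmeas).aemeasurable]
  refine Eventually.of_forall fun ξ => ?_
  have h := ae_fourierLaplace_not_aligned
    (f := fun u => Complex.exp (Complex.I * (inner ℝ ξ (w u) : ℝ))) (by fun_prop)
    (fun u => by rw [mul_comm, Complex.norm_exp_ofReal_mul_I]) hst hts hst'
    (he0 (0, ξ)) (he0' (0, ξ))
  rw [ae_iff] at h
  simp only [not_not, ← Yint_eq_fourierLaplace] at h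
  simp only [Set.preimage_ofPred_eq, hew _ ξ, hew' _ ξ]
  exact h

/-- If a coordinate of the averaged field has a measurable integrand on two non-overlapping
intervals, then this coordinate of `bhat` is measurable. -/
lemma aestronglyMeasurable_of_sigmaIntegrand {d : ℕ} {w : ℝ → Euc d} (hw : Continuous w)
    {bhat : ℝ × Euc d → Fin d → ℂ} {i : Fin d} {s t s' t' : ℝ} (hst : s < t) (hts : t ≤ s')
    (hst' : s' < t') {x x' : Euc d}
    (h : AEStronglyMeasurable (sigmaIntegrand w bhat i s t x))
    (h' : AEStronglyMeasurable (sigmaIntegrand w bhat i s' t' x')) :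
    AEStronglyMeasurable fun p => bhat p i := by
  let e : Euc d → ℝ × Euc d → ℂ := fun x p =>
    Complex.exp (Complex.I * Complex.ofReal (inner ℝ p.2 x))
  have he : ∀ x, Continuous (e x) := fun x => by fun_prop
  have he0 : ∀ x p, e x p ≠ 0 := fun x p => Complex.exp_ne_zero _
  have hne := ae_Yint_not_aligned hw hst hts hst' (he x) (he x') (he0 x) (he0 x')
    (fun _ _ => rfl) (fun _ _ => rfl)
  let z : ℝ × Euc d → ℂ := fun p => Yint w s t p.1 p.2 * e x p
  let z' : ℝ × Euc d → ℂ := fun p => Yint w s' t' p.1 p.2 * e x' p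
  have hz : Continuous z := (continuous_Yint hw s t).mul (he x)
  have hz' : Continuous z' := (continuous_Yint hw s' t').mul (he x')
  have hzc : Continuous fun p => starRingEnd ℂ (z p) := Complex.continuous_conj.comp hz
  have hzc' : Continuous fun p => starRingEnd ℂ (z' p) := Complex.continuous_conj.comp hz'
  have hden : Continuous fun p => z p * starRingEnd ℂ (z' p) - z' p * starRingEnd ℂ (z p) :=
    (hz.mul hzc').sub (hz'.mul hzc)
  have hF := Complex.continuous_ofReal.comp_aestronglyMeasurable h
  have hF' := Complex.continuous_ofReal.comp_aestronglyMeasurable h'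
  have hnum := ((hF.mul hzc'.aestronglyMeasurable).sub (hF'.mul hzc.aestronglyMeasurable)).const_mul
    (2 : ℂ)
  refine (hnum.aemeasurable.div hden.measurable.aemeasurable).aestronglyMeasurable.congr ?_
  filter_upwards [hne] with p hp
  have r : (sigmaIntegrand w bhat i s t x p : ℂ) =
      (bhat p i * z p + starRingEnd ℂ (bhat p i * z p)) / 2 := by
    rw [← Complex.re_eq_add_conj]
    simp only [sigmaIntegrand, z, e, mul_assoc]
  have r' : (sigmaIntegrand w bhat i s' t' x' p : ℂ) =
      (bhat p i * z' p + starRingEnd ℂ (bhat p i * z' p)) / 2 := by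
    rw [← Complex.re_eq_add_conj]
    simp only [sigmaIntegrand, z', e, mul_assoc]
  change 2 * ((sigmaIntegrand w bhat i s t x p : ℂ) * starRingEnd ℂ (z' p) -
    (sigmaIntegrand w bhat i s' t' x' p : ℂ) * starRingEnd ℂ (z p)) /
      (z p * starRingEnd ℂ (z' p) - z' p * starRingEnd ℂ (z p)) = bhat p i
  have hp' : z p * starRingEnd ℂ (z' p) - z' p * starRingEnd ℂ (z p) ≠ 0 := hp
  clear_value z z'
  rw [div_eq_iff hp', r, r', map_mul _ (bhat p i) (z p), map_mul _ (bhat p i) (z' p)]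
  ring

/-- A non-measurable coordinate of `bhat` contributes at most one nonzero term to a Riemann sum. -/
lemma abs_sum_sigmaAvg_apply_le {d : ℕ} {α γ : ℝ} (hγ : 0 ≤ γ) {w : ℝ → Euc d} (hw : Continuous w)
    (hK : avgK w α γ < ⊤) {bhat : ℝ × Euc d → Fin d → ℂ} (hb : FLnorm d (α + 1) bhat < ⊤)
    {i : Fin d} (hm : ¬ AEStronglyMeasurable fun p => bhat p i) (θ : ℝ → Euc d) {t δ : ℝ}
    (ht : t ≤ 1) (hδ : 0 ≤ δ) (P : IntervalPartition 0 t) (hP : P.MeshLt δ) :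
    ‖∑ k ∈ Finset.range P.n, sigmaAvg w bhat (P.pts k) (P.pts (k + 1)) (θ (P.pts k)) i‖ ≤
      (avgK w α γ).toReal * (FLnorm d (α + 1) bhat).toReal * δ ^ γ := by
  set a : ℕ → ℝ := fun k => sigmaAvg w bhat (P.pts k) (P.pts (k + 1)) (θ (P.pts k)) i with ha
  have hint : ∀ k, a k ≠ 0 → AEStronglyMeasurable
      (sigmaIntegrand w bhat i (P.pts k) (P.pts (k + 1)) (θ (P.pts k))) := fun k hk =>
    (not_imp_comm.1 integral_undef hk).aestronglyMeasurable
  have hpos : ∀ k < P.n, a k ≠ 0 → P.pts k < P.pts (k + 1) := by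
    intro k hk hak
    refine (P.mono k hk).lt_of_ne fun heq => hak ?_
    simp [ha, sigmaAvg_apply, sigmaIntegrand, Yint, ← heq]
  have huniq : ∀ k l, k < l → l < P.n → a k ≠ 0 → a l = 0 := by
    intro k l hkl hl hk
    by_contra hal
    exact hm (aestronglyMeasurable_of_sigmaIntegrand hw (hpos k (hkl.trans hl) hk)
      (P.pts_le_pts hkl hl.le) (hpos l hl hal) (hint k hk) (hint l hal))
  by_cases h : ∃ k ∈ Finset.range P.n, a k ≠ 0
  · obtain ⟨k, hk, hak⟩ := h
    rw [Finset.sum_eq_single_of_mem k hk]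
    · have hk' := Finset.mem_range.1 hk
      refine (abs_sigmaAvg_apply_le hK hb (P.le_pts hk'.le) (P.mono k hk')
        ((P.pts_le hk').trans ht) _ i).trans ?_
      rw [mul_right_comm]
      gcongr
      · exact sub_nonneg.2 (P.mono k hk')
      · exact (hP k hk').le
    · intro l hl hlk
      rcases lt_or_gt_of_ne hlk with hlt | hlt
      · by_contra hal
        exact hak (huniq l k hlt (Finset.mem_range.1 hk) hal)
      · exact huniq k l hlt (Finset.mem_range.1 hl) hak
  · push Not at h
    rw [Finset.sum_eq_zero h, norm_zero]
    positivity

open Classical in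
/-- The coordinates of `bhat` that are measurable, the other ones being replaced by zero. -/
def measurablePart {d : ℕ} (bhat : ℝ × Euc d → Fin d → ℂ) (p : ℝ × Euc d) (i : Fin d) : ℂ :=
  if AEStronglyMeasurable (fun q => bhat q i) then bhat p i else 0

lemma aestronglyMeasurable_measurablePart {d : ℕ} (bhat : ℝ × Euc d → Fin d → ℂ) (i : Fin d) :
    AEStronglyMeasurable fun p => measurablePart bhat p i := by
  by_cases h : AEStronglyMeasurable fun q => bhat q i
  · simpa only [measurablePart, if_pos h] using h
  · simpa only [measurablePart, if_neg h] using aestronglyMeasurable_const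

lemma FLnorm_measurablePart_le {d : ℕ} (α : ℝ) (bhat : ℝ × Euc d → Fin d → ℂ) :
    FLnorm d α (measurablePart bhat) ≤ FLnorm d α bhat := by
  refine lintegral_mono fun p => ENNReal.ofReal_le_ofReal ?_
  gcongr
  refine (pi_norm_le_iff_of_nonneg (norm_nonneg _)).2 fun i => ?_
  unfold measurablePart
  split_ifs
  · exact norm_le_pi_norm _ i
  · simp

lemma sigmaAvg_measurablePart_apply_of_aestronglyMeasurable {d : ℕ} (w : ℝ → Euc d)
    {bhat : ℝ × Euc d → Fin d → ℂ} {i : Fin d} (h : AEStronglyMeasurable fun q => bhat q i)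
    (s t : ℝ) (x : Euc d) :
    sigmaAvg w (measurablePart bhat) s t x i = sigmaAvg w bhat s t x i := by
  simp only [sigmaAvg_apply, sigmaIntegrand, measurablePart, if_pos h]

lemma sigmaAvg_measurablePart_apply_of_not_aestronglyMeasurable {d : ℕ} (w : ℝ → Euc d)
    {bhat : ℝ × Euc d → Fin d → ℂ} {i : Fin d} (h : ¬ AEStronglyMeasurable fun q => bhat q i)
    (s t : ℝ) (x : Euc d) :
    sigmaAvg w (measurablePart bhat) s t x i = 0 := by
  simp [sigmaAvg_apply, sigmaIntegrand, measurablePart, if_neg h]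

/-- Non-measurable coordinates of `bhat` do not contribute to the nonlinear Young integral. -/
lemma HasSigmaIntegral.of_measurablePart {d : ℕ} {α γ : ℝ} (hγ : 0 < γ) {w : ℝ → Euc d}
    (hw : Continuous w) (hK : avgK w α γ < ⊤) {bhat : ℝ × Euc d → Fin d → ℂ}
    (hb : FLnorm d (α + 1) bhat < ⊤) {θ : ℝ → Euc d} {t : ℝ} (ht : t ≤ 1) {L : Euc d}
    (h : HasSigmaIntegral w (measurablePart bhat) θ 0 t L) : HasSigmaIntegral w bhat θ 0 t L := by
  intro ε hε
  obtain ⟨δ₁, hδ₁, h1⟩ := h (ε / 2) (by positivity)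
  set B := (avgK w α γ).toReal * (FLnorm d (α + 1) bhat).toReal with hB
  obtain ⟨δ₂, hδ₂, h2⟩ := exists_pos_mul_rpow_lt (d * B) hγ (ε := ε / 2) (by positivity)
  refine ⟨min δ₁ δ₂, lt_min hδ₁ hδ₂, fun P hP => ?_⟩
  have hP1 : P.MeshLt δ₁ := fun i hi => (hP i hi).trans_le (min_le_left _ _)
  have hP2 : P.MeshLt δ₂ := fun i hi => (hP i hi).trans_le (min_le_right _ _)
  have hdiff : ‖sigmaRiemannSum w bhat θ P - sigmaRiemannSum w (measurablePart bhat) θ P‖ ≤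
      d * (B * δ₂ ^ γ) := by
    refine norm_le_of_forall_apply_le fun i => ?_
    simp only [sigmaRiemannSum, PiLp.sub_apply, WithLp.ofLp_sum, Finset.sum_apply]
    by_cases hm : AEStronglyMeasurable fun q => bhat q i
    · simp only [sigmaAvg_measurablePart_apply_of_aestronglyMeasurable w hm, sub_self, norm_zero]
      positivity
    · simp only [sigmaAvg_measurablePart_apply_of_not_aestronglyMeasurable w hm,
        Finset.sum_const_zero, sub_zero]
      exact abs_sum_sigmaAvg_apply_le hγ.le hw hK hb hm θ ht hδ₂.le P hP2
  rw [← mul_assoc] at hdiff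
  have h3 := h1 P hP1
  have h4 := norm_sub_le_norm_sub_add_norm_sub (sigmaRiemannSum w bhat θ P)
    (sigmaRiemannSum w (measurablePart bhat) θ P) L
  linarith

lemma exists_solvesSigmaYoung_of_continuous {d : ℕ} {α γ : ℝ} (hγ : 1 / 2 < γ)
    {w : ℝ → Euc d} (hw : Continuous w) (hK : avgK w α γ < ⊤)
    {bhat : ℝ × Euc d → Fin d → ℂ} (hb : FLnorm d (α + 1) bhat < ⊤) (x₀ : Euc d) :
    ∃ θ : ℝ → Euc d, HolderOnIcc γ θ ∧ SolvesSigmaYoung w bhat x₀ θ := by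
  have hγ0 : 0 < γ := by linarith
  have hb' := (FLnorm_measurablePart_le (α + 1) bhat).trans_lt hb
  obtain ⟨θ, C, hC, rfl, h⟩ := exists_path_sigmaAvg_remainder_le hγ hw hK hb'
    (aestronglyMeasurable_measurablePart bhat) x₀
  exact ⟨θ, holderOnIcc_of_remainder_le hγ0.le hK hb' hC h, rfl, fun t ht =>
    (hasSigmaIntegral_of_remainder_le hγ hC h ht.2).of_measurablePart hγ0 hw hK hb ht.2⟩

lemma Yint_congr {d : ℕ} {w w' : ℝ → Euc d} {s t : ℝ} (hst : s ≤ t)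
    (h : ∀ u ∈ Set.Icc s t, w u = w' u) (ω : ℝ) (ξ : Euc d) :
    Yint w s t ω ξ = Yint w' s t ω ξ := by
  refine intervalIntegral.integral_congr fun u hu => ?_
  rw [Set.uIcc_of_le hst] at hu
  simp only [h u hu]

lemma avgK_congr {d : ℕ} {w w' : ℝ → Euc d} (h : ∀ u ∈ Set.Icc (0 : ℝ) 1, w u = w' u)
    (α γ : ℝ) : avgK w α γ = avgK w' α γ := by
  unfold avgK
  refine iSup_congr fun s => iSup_congr fun t => iSup_congr fun hs => iSup_congr fun hst =>
    iSup_congr fun ht => iSup_congr fun ω => iSup_congr fun ξ => ?_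
  rw [Yint_congr hst.le fun u hu => h u ⟨hs.trans hu.1, hu.2.trans ht⟩]

lemma sigmaRiemannSum_congr {d : ℕ} {w w' : ℝ → Euc d}
    (h : ∀ u ∈ Set.Icc (0 : ℝ) 1, w u = w' u) (bhat : ℝ × Euc d → Fin d → ℂ) (θ : ℝ → Euc d)
    {t : ℝ} (ht : t ≤ 1) (P : IntervalPartition 0 t) :
    sigmaRiemannSum w bhat θ P = sigmaRiemannSum w' bhat θ P := by
  refine Finset.sum_congr rfl fun k hk => ?_
  have hk' := Finset.mem_range.1 hk
  have hY := Yint_congr (P.mono k hk') fun u hu =>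
    h u ⟨(P.le_pts hk'.le).trans hu.1, hu.2.trans ((P.pts_le hk').trans ht)⟩
  simp only [sigmaAvg, hY]

/-- Existence of a `γ`-Hölder solution of the Young equation
`θ_t = x₀ + ∫_0^t (σ^w_{du} b)(θ_u)` on `[0,1]` for `b ∈ FL^{α+1}`, when `K^w_{α,γ} < ∞`
and `γ > 1/2`. -/
theorem statement8 (d : ℕ) (α γ : ℝ) (hγ : 1 / 2 < γ) (hγ1 : γ ≤ 1)
    (w : ℝ → Euc d) (hw : ContinuousOn w (Set.Icc 0 1)) (hK : avgK w α γ < ⊤)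
    (bhat : ℝ × Euc d → Fin d → ℂ) (hb : FLnorm d (α + 1) bhat < ⊤) (x₀ : Euc d) :
    ∃ θ : ℝ → Euc d, HolderOnIcc γ θ ∧ SolvesSigmaYoung w bhat x₀ θ := by
  set w' : ℝ → Euc d := Set.IccExtend zero_le_one ((Set.Icc (0 : ℝ) 1).domRestrict w) with hw'
  have hcont : Continuous w' := (continuousOn_iff_continuous_domRestrict.1 hw).Icc_extend'
  have heq : ∀ u ∈ Set.Icc (0 : ℝ) 1, w u = w' u := fun u hu => by
    rw [hw', Set.IccExtend_of_mem _ _ hu, Set.domRestrict_apply]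
  obtain ⟨θ, hθ, h0, h⟩ := exists_solvesSigmaYoung_of_continuous hγ hcont
    (avgK_congr heq α γ ▸ hK) hb x₀
  refine ⟨θ, hθ, h0, fun t ht ε hε => ?_⟩
  obtain ⟨δ, hδ, H⟩ := h t ht ε hε
  exact ⟨δ, hδ, fun P hP => sigmaRiemannSum_congr heq bhat θ ht.2 P ▸ H P hP⟩

end
end
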